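/- arXiv:1806.03727 — 5 statements merged into one kernel-verified Lean document; each statement's English description precedes it below -/
import Mathlib

section
/- Let δ > -1 and ρ > 0. For k ∈ ℕ set A_k^δ = Γ(k+δ+1)/(Γ(k+1)·Γ(δ+1)), and for a sequence (a_k) of real numbers set S_N^δ = (1/A_N^δ) · Σ_{k=0}^{N} A_{N-k}^δ · a_k. Then for every N ∈ ℕ, |S_N^{δ+ρ}| ≤ max_{0 ≤ k ≤ N} |S_k^δ|. -/
/-- The generalized binomial coefficient `A_k^δ = Γ(k+δ+1)/(Γ(k+1)·Γ(δ+1))`. -/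
noncomputable def cesaroA (δ : ℝ) (k : ℕ) : ℝ :=
  Real.Gamma ((k : ℝ) + δ + 1) / (Real.Gamma ((k : ℝ) + 1) * Real.Gamma (δ + 1))

/-- The Cesàro (C,δ) mean `S_N^δ = (1/A_N^δ) Σ_{k=0}^N A_{N-k}^δ a_k`. -/
noncomputable def cesaroMean (δ : ℝ) (a : ℕ → ℝ) (N : ℕ) : ℝ :=
  (1 / cesaroA δ N) * ∑ k ∈ Finset.range (N + 1), cesaroA δ (N - k) * a k

theorem cesaroA_pos {δ : ℝ} (hδ : -1 < δ) (k : ℕ) : 0 < cesaroA δ k := by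
  have hk : (0 : ℝ) ≤ k := k.cast_nonneg
  exact div_pos (Real.Gamma_pos_of_pos (by linarith))
    (mul_pos (Real.Gamma_pos_of_pos (by linarith)) (Real.Gamma_pos_of_pos (by linarith)))

theorem cesaroA_zero {δ : ℝ} (hδ : -1 < δ) : cesaroA δ 0 = 1 := by
  have h : Real.Gamma (δ + 1) ≠ 0 := (Real.Gamma_pos_of_pos (by linarith)).ne'
  simp [cesaroA, h]

theorem cesaroA_succ {δ : ℝ} (hδ : -1 < δ) (k : ℕ) :
    (k + 1 : ℝ) * cesaroA δ (k + 1) = (k + δ + 1) * cesaroA δ k := by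
  have hk : (0 : ℝ) ≤ k := k.cast_nonneg
  have h₁ : Real.Gamma (δ + 1) ≠ 0 := (Real.Gamma_pos_of_pos (by linarith)).ne'
  have h₂ : Real.Gamma ((k : ℝ) + 1) ≠ 0 := (Real.Gamma_pos_of_pos (by linarith)).ne'
  have h₃ : (k + 1 : ℝ) ≠ 0 := by positivity
  have h₄ := Real.Gamma_add_one (s := (k : ℝ) + δ + 1) (by linarith)
  have h₅ := Real.Gamma_add_one (s := (k : ℝ) + 1) h₃
  unfold cesaroA
  push_cast
  rw [show (k : ℝ) + 1 + δ + 1 = k + δ + 1 + 1 by ring, h₄, h₅]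
  field_simp

theorem cesaroA_eq_choose {δ : ℝ} (hδ : -1 < δ) (k : ℕ) :
    cesaroA δ k = (-1) ^ k * Ring.choose (-(δ + 1)) k := by
  induction k with
  | zero => simp [cesaroA_zero hδ]
  | succ k ih =>
    have h₃ : (k + 1 : ℝ) ≠ 0 := by positivity
    have h := Ring.choose_add_smul_choose (-(δ + 1) - k) 1 k
    apply mul_left_cancel₀ h₃
    rw [cesaroA_succ hδ, ih]
    have h' : (k + 1 : ℝ) * Ring.choose (-(δ + 1)) (k + 1) =
        (-(δ + 1) - k) * Ring.choose (-(δ + 1)) k := by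
      simpa [add_comm 1 k, mul_comm (Ring.choose _ k)] using h
    rw [pow_succ]
    linear_combination (-1) ^ k * h'

/-- The generating function of `cesaroA δ` is `(1 - X) ^ (-(δ + 1))`, so these functions
multiply by adding exponents. -/
theorem mk_cesaroA_mul {α β : ℝ} (hα : -1 < α) (hβ : -1 < β) (h : -1 < α + β + 1) :
    PowerSeries.mk (cesaroA α) * PowerSeries.mk (cesaroA β) =
      PowerSeries.mk (cesaroA (α + β + 1)) := by
  ext n
  rw [PowerSeries.coeff_mul, PowerSeries.coeff_mk, cesaroA_eq_choose h,
    show -(α + β + 1 + 1) = -(α + 1) + -(β + 1) by ring,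
    Ring.add_choose_eq n (Commute.all _ _), Finset.mul_sum]
  refine Finset.sum_congr rfl fun p hp => ?_
  rw [PowerSeries.coeff_mk, PowerSeries.coeff_mk, cesaroA_eq_choose hα, cesaroA_eq_choose hβ,
    ← Finset.HasAntidiagonal.mem_antidiagonal.mp hp, pow_add]
  ring

theorem cesaroA_mul_cesaroMean {δ : ℝ} (hδ : -1 < δ) (a : ℕ → ℝ) (N : ℕ) :
    cesaroA δ N * cesaroMean δ a N =
      PowerSeries.coeff N (PowerSeries.mk (cesaroA δ) * PowerSeries.mk a) := by
  have h := (cesaroA_pos hδ N).ne'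
  rw [mul_comm (PowerSeries.mk _), PowerSeries.coeff_mul,
    Finset.Nat.sum_antidiagonal_eq_sum_range_succ_mk, cesaroMean]
  simp only [PowerSeries.coeff_mk]
  rw [← mul_assoc, mul_one_div_cancel h, one_mul]
  exact Finset.sum_congr rfl fun _ _ => mul_comm _ _

theorem stmt_0 (δ ρ : ℝ) (hδ : -1 < δ) (hρ : 0 < ρ) (a : ℕ → ℝ) (N : ℕ) :
    |cesaroMean (δ + ρ) a N| ≤
      (Finset.range (N + 1)).sup' (by simp) (fun k => |cesaroMean δ a k|) := by
  have hρ' : -1 < ρ - 1 := by linarith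
  have hδρ : -1 < δ + ρ := by linarith
  have hmul : PowerSeries.mk (cesaroA (ρ - 1)) * PowerSeries.mk (cesaroA δ) =
      PowerSeries.mk (cesaroA (δ + ρ)) := by
    have h := mk_cesaroA_mul hρ' hδ (by linarith)
    rwa [show ρ - 1 + δ + 1 = δ + ρ by ring] at h
  set M := (Finset.range (N + 1)).sup' (by simp) (fun k => |cesaroMean δ a k|)
  have hM : ∀ k ≤ N, |cesaroMean δ a k| ≤ M := fun k hk =>
    Finset.le_sup' (fun k => |cesaroMean δ a k|) (Finset.mem_range_succ_iff.mpr hk)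
  have hpos := cesaroA_pos hδρ N
  have hmean : cesaroA (δ + ρ) N * cesaroMean (δ + ρ) a N =
      ∑ p ∈ Finset.HasAntidiagonal.antidiagonal N,
        cesaroA (ρ - 1) p.1 * (cesaroA δ p.2 * cesaroMean δ a p.2) := by
    rw [cesaroA_mul_cesaroMean hδρ, ← hmul, mul_assoc, PowerSeries.coeff_mul]
    simp only [cesaroA_mul_cesaroMean hδ, PowerSeries.coeff_mk]
  have hsum : cesaroA (δ + ρ) N =
      ∑ p ∈ Finset.HasAntidiagonal.antidiagonal N, cesaroA (ρ - 1) p.1 * cesaroA δ p.2 := by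
    simpa [PowerSeries.coeff_mul] using (congrArg (PowerSeries.coeff N) hmul).symm
  refine le_of_mul_le_mul_left ?_ hpos
  calc cesaroA (δ + ρ) N * |cesaroMean (δ + ρ) a N|
      = |∑ p ∈ Finset.HasAntidiagonal.antidiagonal N,
          cesaroA (ρ - 1) p.1 * (cesaroA δ p.2 * cesaroMean δ a p.2)| := by
        rw [← hmean, abs_mul, abs_of_pos hpos]
    _ ≤ ∑ p ∈ Finset.HasAntidiagonal.antidiagonal N,
          |cesaroA (ρ - 1) p.1 * (cesaroA δ p.2 * cesaroMean δ a p.2)| :=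
        Finset.abs_sum_le_sum_abs _ _
    _ ≤ ∑ p ∈ Finset.HasAntidiagonal.antidiagonal N, cesaroA (ρ - 1) p.1 * cesaroA δ p.2 * M := by
        refine Finset.sum_le_sum fun p hp => ?_
        have h₁ := cesaroA_pos hρ' p.1
        have h₂ := cesaroA_pos hδ p.2
        rw [← mul_assoc, abs_mul, abs_of_pos (mul_pos h₁ h₂)]
        exact mul_le_mul_of_nonneg_left (hM _ (Finset.HasAntidiagonal.antidiagonal.snd_le hp))
          (mul_pos h₁ h₂).le
    _ = cesaroA (δ + ρ) N * M := by rw [hsum, Finset.sum_mul]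
end

section
/- For every integer n ≥ 2 there exists a constant C > 0 (depending only on n) such that for every 0 < r ≤ π, every maximal r-separated finite set {y_1, …, y_m} ⊂ 𝕊^n, and every x ∈ 𝕊^n with x ∉ {y_1,…,y_m}, one has (1/m) · Σ_{j=1}^{m} d(x,y_j)^{-n} ≥ C · log(π/r). -/
/-- The unit sphere `𝕊^n ⊂ ℝ^{n+1}`. -/
def unitSphere (n : ℕ) : Set (EuclideanSpace ℝ (Fin (n + 1))) := Metric.sphere 0 1

/-- The great-circle distance `d(x,y) = arccos⟨x,y⟩` on the unit sphere. -/
noncomputable def gcDist {n : ℕ} (x y : EuclideanSpace ℝ (Fin (n + 1))) : ℝ :=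
  Real.arccos (@inner ℝ _ _ x y)

open MeasureTheory Metric Module

theorem finrank_mul_log_inv_le_of_cover {F ι : Type*} [NormedAddCommGroup F]
    [InnerProductSpace ℝ F] [FiniteDimensional ℝ F] [Nontrivial F] (Y : Finset ι) (p : ι → F)
    (d : ι → ℝ) (hd : ∀ y ∈ Y, 0 < d y) {r K : ℝ} (hK : 0 < K) (hr : 0 < r) (hr1 : r ≤ 1)
    (hcov : ∀ w : F, r ≤ ‖w‖ → ‖w‖ < 1 → ∃ y ∈ Y, ‖w - p y‖ < r ∧ d y ≤ K * ‖w‖) :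
    (finrank ℝ F : ℝ) * Real.log (1 / r) ≤
      K ^ finrank ℝ F * r ^ finrank ℝ F * ∑ y ∈ Y, 1 / d y ^ finrank ℝ F := by
  let : MeasurableSpace F := borel F
  have : BorelSpace F := ⟨rfl⟩
  let μ : Measure F := Measure.addHaar
  set n := finrank ℝ F with hn
  have hn0 : 0 < n := finrank_pos
  let f : ℝ → ℝ := (Set.Ioo r 1).indicator fun t => (t ^ n)⁻¹
  let g : F → ℝ := fun w => ∑ y ∈ Y, (ball (p y) r).indicator (fun _ => K ^ n / d y ^ n) w
  have hf0 : ∀ w : F, 0 ≤ f ‖w‖ := fun w =>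
    Set.indicator_nonneg (fun t ht => inv_nonneg.2 (pow_nonneg (hr.le.trans ht.1.le) _)) _
  have hfg : ∀ w : F, f ‖w‖ ≤ g w := by
    intro w
    have hterm : ∀ y ∈ Y, 0 ≤ (ball (p y) r).indicator (fun _ => K ^ n / d y ^ n) w :=
      fun y hy => Set.indicator_nonneg (fun _ _ => by have := hd y hy; positivity) _
    by_cases hw : ‖w‖ ∈ Set.Ioo r 1
    · obtain ⟨y, hy, hwy, hdy⟩ := hcov w hw.1.le hw.2
      refine le_trans ?_ (Finset.single_le_sum hterm hy)
      have hmem : w ∈ ball (p y) r := by simpa [dist_eq_norm] using hwy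
      simp only [f, Set.indicator_of_mem hw, Set.indicator_of_mem hmem]
      have hw0 : 0 < ‖w‖ := hr.trans hw.1
      have := hd y hy
      rw [inv_eq_one_div, div_le_div_iff₀ (by positivity) (by positivity), one_mul, ← mul_pow]
      gcongr
    · simp only [f, Set.indicator_of_notMem hw]
      exact Finset.sum_nonneg hterm
  have hint : ∀ y ∈ Y, Integrable ((ball (p y) r).indicator fun _ => K ^ n / d y ^ n) μ :=
    fun y _ => (integrable_indicator_iff measurableSet_ball).2
      (integrableOn_const measure_ball_lt_top.ne)
  have hle : ∫ w, f ‖w‖ ∂μ ≤ ∫ w, g w ∂μ :=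
    integral_mono_of_nonneg (.of_forall hf0) (integrable_finsetSum _ hint) (.of_forall hfg)
  have hω : 0 < μ.real (ball 0 1) :=
    ENNReal.toReal_pos (measure_ball_pos μ _ one_pos).ne' measure_ball_lt_top.ne
  have hball : ∀ y, μ.real (ball (p y) r) = r ^ n * μ.real (ball 0 1) := by
    intro y
    rw [measureReal_def, Measure.addHaar_ball μ _ hr.le, ENNReal.toReal_mul,
      ENNReal.toReal_ofReal (by positivity), ← measureReal_def]
  have hg : ∫ w, g w ∂μ = μ.real (ball 0 1) * (K ^ n * r ^ n * ∑ y ∈ Y, 1 / d y ^ n) := by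
    rw [integral_finsetSum _ hint, Finset.mul_sum, Finset.mul_sum]
    refine Finset.sum_congr rfl fun y _ => ?_
    rw [integral_indicator measurableSet_ball, setIntegral_const, hball, smul_eq_mul]
    ring
  have hlog : ∫ t in Set.Ioi (0 : ℝ), t ^ (n - 1) • f t = Real.log (1 / r) := by
    rw [← integral_inv_of_pos hr one_pos, intervalIntegral.integral_of_le hr1,
      integral_Ioc_eq_integral_Ioo]
    have hIoo : Set.Ioi (0 : ℝ) ∩ Set.Ioo r 1 = Set.Ioo r 1 :=
      Set.inter_eq_right.2 fun t ht => hr.trans ht.1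
    rw [← hIoo, ← setIntegral_indicator measurableSet_Ioo]
    refine setIntegral_congr_fun measurableSet_Ioi fun t ht => ?_
    by_cases htr : t ∈ Set.Ioo r 1
    · have ht0 : t ≠ 0 := (Set.mem_Ioi.1 ht).ne'
      simp only [f, Set.indicator_of_mem htr, smul_eq_mul]
      obtain ⟨k, hk⟩ : ∃ k, n = k + 1 := ⟨n - 1, by omega⟩
      rw [hk, Nat.add_sub_cancel, pow_succ]
      field_simp
    · simp [f, Set.indicator_of_notMem htr]
  rw [integral_fun_norm_addHaar, hlog, hg] at hle
  simp only [nsmul_eq_mul, smul_eq_mul, ← hn] at hle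
  refine le_of_mul_le_mul_left (?_ : μ.real (ball 0 1) * _ ≤ μ.real (ball 0 1) * _) hω
  linarith

theorem card_mul_pow_le_of_separated {E : Type*} [NormedAddCommGroup E]
    [InnerProductSpace ℝ E] [FiniteDimensional ℝ E] [Nontrivial E] (Y : Finset E)
    (hY : ∀ y ∈ Y, ‖y‖ = 1) {s : ℝ} (hs : 0 < s) (hs1 : s ≤ 1)
    (hsep : ∀ y ∈ Y, ∀ y' ∈ Y, y ≠ y' → 2 * s ≤ ‖y - y'‖) :
    (Y.card : ℝ) * s ^ finrank ℝ E ≤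
      (1 + s) ^ finrank ℝ E - (1 - s) ^ finrank ℝ E := by
  let : MeasurableSpace E := borel E
  have : BorelSpace E := ⟨rfl⟩
  let μ : Measure E := Measure.addHaar
  set n := finrank ℝ E
  have hω : 0 < μ.real (ball 0 1) :=
    ENNReal.toReal_pos (measure_ball_pos μ _ one_pos).ne' measure_ball_lt_top.ne
  have hball : ∀ (y : E) {t : ℝ}, 0 ≤ t → μ.real (ball y t) = t ^ n * μ.real (ball 0 1) := by
    intro y t ht
    rw [measureReal_def, Measure.addHaar_ball μ _ ht, ENNReal.toReal_mul,
      ENNReal.toReal_ofReal (by positivity), ← measureReal_def]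
  have hU : μ.real (⋃ y ∈ Y, ball y s) = Y.card * (s ^ n * μ.real (ball 0 1)) := by
    rw [measureReal_biUnion_finset]
    · simp [hball _ hs.le]
    · intro y hy y' hy' hne
      refine ball_disjoint_ball ?_
      rw [dist_eq_norm]
      linarith [hsep y hy y' hy' hne]
    · exact fun _ _ => measurableSet_ball
  have hdisj : Disjoint (⋃ y ∈ Y, ball y s) (ball (0 : E) (1 - s)) := by
    simp only [Set.disjoint_iUnion_left]
    intro y hy
    refine ball_disjoint_ball ?_
    simp [hY y hy]
  have hsub : (⋃ y ∈ Y, ball y s) ∪ ball (0 : E) (1 - s) ⊆ ball 0 (1 + s) := by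
    refine Set.union_subset (Set.iUnion₂_subset fun y hy => ball_subset_ball' ?_)
      (ball_subset_ball (by linarith))
    simp [hY y hy, add_comm]
  have hle := measureReal_mono (μ := μ) hsub measure_ball_lt_top.ne
  have hUfin : μ (⋃ y ∈ Y, ball y s) ≠ ⊤ :=
    measure_ne_top_of_subset (Set.subset_union_left.trans hsub) measure_ball_lt_top.ne
  rw [measureReal_union hdisj measurableSet_ball hUfin measure_ball_lt_top.ne, hU,
    hball 0 (sub_nonneg.2 hs1), hball 0 (by linarith : 0 ≤ 1 + s), ← mul_assoc, ← add_mul] at hle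
  linarith [le_of_mul_le_mul_right hle hω]

theorem card_mul_pow_le {n : ℕ} (Y : Finset (EuclideanSpace ℝ (Fin (n + 1))))
    (hY : ∀ y ∈ Y, ‖y‖ = 1) {r : ℝ} (hr : 0 < r) (hr1 : r ≤ 1)
    (hsep : ∀ y ∈ Y, ∀ y' ∈ Y, y ≠ y' → r ≤ 2 * ‖y - y'‖) :
    (Y.card : ℝ) * r ^ n ≤ 2 * (n + 1) * 8 ^ n := by
  have h := card_mul_pow_le_of_separated Y hY (s := r / 4) (by linarith) (by linarith)
    fun y hy y' hy' hne => by linarith [hsep y hy y' hy' hne]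
  rw [finrank_euclideanSpace_fin] at h
  have h2 := (le_abs_self _).trans (abs_pow_sub_pow_le (1 + r / 4) (1 - r / 4) (n + 1))
  have h3 : max |1 + r / 4| |1 - r / 4| ≤ 2 := by
    refine max_le ?_ ?_ <;> rw [abs_le] <;> constructor <;> linarith
  have h4 : max |1 + r / 4| |1 - r / 4| ^ n ≤ 2 ^ n :=
    pow_le_pow_left₀ (le_max_of_le_left (abs_nonneg _)) h3 n
  have h5 : |1 + r / 4 - (1 - r / 4)| = 2 * (r / 4) := by
    rw [abs_of_nonneg] <;> linarith
  rw [Nat.add_sub_cancel, h5] at h2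
  have h6 : (Y.card : ℝ) * (r / 4) ^ n * (r / 4) ≤ 2 * (n + 1) * 2 ^ n * (r / 4) := by
    calc (Y.card : ℝ) * (r / 4) ^ n * (r / 4) = Y.card * (r / 4) ^ (n + 1) := by ring
      _ ≤ 2 * (r / 4) * ↑(n + 1) * max |1 + r / 4| |1 - r / 4| ^ n := h.trans h2
      _ ≤ 2 * (r / 4) * ↑(n + 1) * 2 ^ n := by gcongr
      _ = _ := by push_cast; ring
  have h7 := le_of_mul_le_mul_right h6 (by linarith)
  calc (Y.card : ℝ) * r ^ n = Y.card * (r / 4) ^ n * 4 ^ n := by rw [div_pow]; field_simp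
    _ ≤ 2 * (n + 1) * 2 ^ n * 4 ^ n := by gcongr
    _ = 2 * (n + 1) * 8 ^ n := by rw [mul_assoc, ← mul_pow]; norm_num

section gcDist

variable {n : ℕ} {x y : EuclideanSpace ℝ (Fin (n + 1))}

theorem gcDist_le_pi (x y : EuclideanSpace ℝ (Fin (n + 1))) : gcDist x y ≤ Real.pi :=
  Real.arccos_le_pi _

theorem gcDist_nonneg (x y : EuclideanSpace ℝ (Fin (n + 1))) : 0 ≤ gcDist x y :=
  Real.arccos_nonneg _

theorem norm_sub_sq_eq_cos_gcDist (hx : ‖x‖ = 1) (hy : ‖y‖ = 1) :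
    ‖x - y‖ ^ 2 = 2 - 2 * Real.cos (gcDist x y) := by
  have h := abs_le.1 (abs_real_inner_le_norm x y)
  rw [hx, hy, mul_one] at h
  rw [gcDist, Real.cos_arccos h.1 h.2, norm_sub_sq_real, hx, hy]
  ring

theorem norm_sub_le_gcDist (hx : ‖x‖ = 1) (hy : ‖y‖ = 1) : ‖x - y‖ ≤ gcDist x y := by
  refine (pow_le_pow_iff_left₀ (norm_nonneg _) (gcDist_nonneg x y) two_ne_zero).1 ?_
  have := Real.one_sub_sq_div_two_le_cos (x := gcDist x y)
  rw [norm_sub_sq_eq_cos_gcDist hx hy]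
  linarith

theorem gcDist_le_two_mul_norm_sub (hx : ‖x‖ = 1) (hy : ‖y‖ = 1) :
    gcDist x y ≤ 2 * ‖x - y‖ := by
  refine (pow_le_pow_iff_left₀ (gcDist_nonneg x y) (by positivity) two_ne_zero).1 ?_
  have h0 : 0 ≤ gcDist x y := gcDist_nonneg x y
  have := Real.cos_le_one_sub_mul_cos_sq (x := gcDist x y)
    (by rw [abs_of_nonneg h0]; exact gcDist_le_pi x y)
  rw [mul_pow, norm_sub_sq_eq_cos_gcDist hx hy]
  have hpi : 1 / 8 ≤ 2 / Real.pi ^ 2 := by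
    rw [div_le_div_iff₀ (by norm_num) (by positivity)]
    nlinarith [Real.pi_le_four, Real.pi_pos]
  nlinarith [mul_le_mul_of_nonneg_right hpi (sq_nonneg (gcDist x y))]

theorem gcDist_pos (hx : ‖x‖ = 1) (hy : ‖y‖ = 1) (hne : x ≠ y) : 0 < gcDist x y :=
  (norm_pos_iff.2 (sub_ne_zero.2 hne)).trans_le (norm_sub_le_gcDist hx hy)

end gcDist

theorem exists_gcDist_le_of_cover {n : ℕ} (Y : Finset (EuclideanSpace ℝ (Fin (n + 1))))
    (hY : ∀ y ∈ Y, ‖y‖ = 1) {r : ℝ}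
    (hcov : ∀ x : EuclideanSpace ℝ (Fin (n + 1)), ‖x‖ = 1 → ∃ y ∈ Y, gcDist x y < r)
    {x : EuclideanSpace ℝ (Fin (n + 1))} (hx : ‖x‖ = 1) (w : (ℝ ∙ x)ᗮ)
    (hrw : r ≤ ‖w‖) (hw1 : ‖w‖ < 1) :
    ∃ y ∈ Y, ‖w - (ℝ ∙ x)ᗮ.orthogonalProjectionOnto y‖ < r ∧ gcDist x y ≤ 6 * ‖w‖ := by
  have hxw : inner ℝ x (w : EuclideanSpace ℝ (Fin (n + 1))) = 0 :=
    Submodule.mem_orthogonal_singleton_iff_inner_right.1 w.2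
  set t : ℝ := √(1 - ‖w‖ ^ 2)
  have hw0 := norm_nonneg w
  have ht0 : 0 ≤ t := Real.sqrt_nonneg _
  have ht2 : t ^ 2 = 1 - ‖w‖ ^ 2 := Real.sq_sqrt (by nlinarith)
  have hnorm : ∀ c : ℝ, ‖c • x + (w : EuclideanSpace ℝ (Fin (n + 1)))‖ ^ 2 = c ^ 2 + ‖w‖ ^ 2 := by
    intro c
    rw [norm_add_sq_real, inner_smul_left, hxw, norm_smul, hx]
    simp
  set z := t • x + (w : EuclideanSpace ℝ (Fin (n + 1))) with hz
  have hz1 : ‖z‖ = 1 := by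
    have := hnorm t
    rw [ht2, sub_add_cancel] at this
    exact (pow_eq_one_iff_of_nonneg (norm_nonneg z) two_ne_zero).1 this
  have hzx : ‖z - x‖ ≤ 2 * ‖w‖ := by
    have h := hnorm (t - 1)
    rw [sub_smul, one_smul, sub_add_eq_add_sub, ← hz] at h
    refine (pow_le_pow_iff_left₀ (norm_nonneg _) (by positivity) two_ne_zero).1 ?_
    have ht1 : t ≤ 1 := by nlinarith
    nlinarith
  obtain ⟨y, hy, hzy⟩ := hcov z hz1
  have hzy' := (norm_sub_le_gcDist hz1 (hY y hy)).trans_lt hzy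
  refine ⟨y, hy, ?_, ?_⟩
  · have hPz : (ℝ ∙ x)ᗮ.orthogonalProjectionOnto z = w := by
      rw [hz, map_add, map_smul, Submodule.orthogonalProjectionOnto_mem_subspace_eq_self]
      simp
    calc ‖w - (ℝ ∙ x)ᗮ.orthogonalProjectionOnto y‖
        = ‖(ℝ ∙ x)ᗮ.orthogonalProjectionOnto (z - y)‖ := by rw [map_sub, hPz]
      _ ≤ ‖z - y‖ := Submodule.norm_orthogonalProjectionOnto_apply_le _ _
      _ < r := hzy'
  · have h1 := gcDist_le_two_mul_norm_sub hx (hY y hy)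
    have h2 := norm_sub_le_norm_sub_add_norm_sub x z y
    rw [norm_sub_rev x z] at h2
    linarith

theorem stmt_5 (n : ℕ) (hn : 2 ≤ n) :
    ∃ C > (0 : ℝ), ∀ r : ℝ, 0 < r → r ≤ Real.pi →
      ∀ Y : Finset (EuclideanSpace ℝ (Fin (n + 1))),
        (Y : Set (EuclideanSpace ℝ (Fin (n + 1)))) ⊆ unitSphere n →
        (∀ y ∈ Y, ∀ y' ∈ Y, y ≠ y' → r ≤ gcDist y y') →
        (∀ x ∈ unitSphere n, ∃ y ∈ Y, gcDist x y < r) →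
        ∀ x ∈ unitSphere n, x ∉ Y →
          C * Real.log (Real.pi / r) ≤
            (1 / (Y.card : ℝ)) * ∑ y ∈ Y, 1 / gcDist x y ^ n := by
  have hn0 : (0 : ℝ) < n := by exact_mod_cast (by omega : 0 < n)
  set c : ℝ := n / (6 ^ n * (2 * (n + 1) * 8 ^ n)) with hc
  have hc0 : 0 < c := by positivity
  have hpin : 0 < 1 / Real.pi ^ n := by positivity
  refine ⟨min (1 / Real.pi ^ n / 4) (c / 2), lt_min (by positivity) (by positivity), ?_⟩
  intro r hr _ Y hYs hsep hcov x hxs hxY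
  have hmem : ∀ v : EuclideanSpace ℝ (Fin (n + 1)), v ∈ unitSphere n ↔ ‖v‖ = 1 := fun v => by
    simp [unitSphere]
  have hY : ∀ y ∈ Y, ‖y‖ = 1 := fun y hy => (hmem y).1 (hYs hy)
  have hx := (hmem x).1 hxs
  have hcov' : ∀ v : EuclideanSpace ℝ (Fin (n + 1)), ‖v‖ = 1 → ∃ y ∈ Y, gcDist v y < r :=
    fun v hv => hcov v ((hmem v).2 hv)
  have hd : ∀ y ∈ Y, 0 < gcDist x y := fun y hy =>
    gcDist_pos hx (hY y hy) fun h => hxY (h ▸ hy)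
  have hcard : (0 : ℝ) < Y.card := by
    obtain ⟨y, hy, _⟩ := hcov' x hx
    exact_mod_cast Finset.card_pos.2 ⟨y, hy⟩
  set S := ∑ y ∈ Y, 1 / gcDist x y ^ n with hS
  set C := min (1 / Real.pi ^ n / 4) (c / 2)
  have hC0 : 0 < C := lt_min (by positivity) (by positivity)
  have hC1 : C ≤ 1 / Real.pi ^ n / 4 := min_le_left _ _
  have hC2 : C ≤ c / 2 := min_le_right _ _
  have htriv : 1 / Real.pi ^ n ≤ 1 / (Y.card : ℝ) * S := by
    have h : (Y.card : ℝ) * (1 / Real.pi ^ n) ≤ S := by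
      rw [← nsmul_eq_mul]
      refine Finset.card_nsmul_le_sum _ _ _ fun y hy => ?_
      have := hd y hy
      have := gcDist_le_pi x y
      gcongr
    rw [one_div_mul_eq_div, le_div_iff₀ hcard]
    linarith
  have hlogpi : Real.log Real.pi ≤ 2 := by
    rw [Real.log_le_iff_le_exp Real.pi_pos]
    have h := Real.add_one_le_exp (1 : ℝ)
    have h2 : Real.exp 2 = Real.exp 1 * Real.exp 1 := by rw [← Real.exp_add]; norm_num
    nlinarith [Real.pi_le_four]
  have hlogsplit : Real.log (Real.pi / r) = Real.log Real.pi + Real.log (1 / r) := by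
    rw [← Real.log_mul Real.pi_ne_zero (by positivity), mul_one_div]
  rw [hlogsplit]
  rcases le_total r 1 with hr1 | hr1
  · have hL : 0 ≤ Real.log (1 / r) := Real.log_nonneg (by rwa [le_div_iff₀ hr, one_mul])
    have hfact : Fact (finrank ℝ (EuclideanSpace ℝ (Fin (n + 1))) = n + 1) :=
      ⟨finrank_euclideanSpace_fin⟩
    have hfin : finrank ℝ (ℝ ∙ x)ᗮ = n :=
      Submodule.finrank_orthogonal_span_singleton (norm_ne_zero_iff.1 (by simp [hx]))
    have hnt : Nontrivial (ℝ ∙ x)ᗮ := nontrivial_of_finrank_pos (R := ℝ) (by omega)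
    have hmain := finrank_mul_log_inv_le_of_cover Y
      (fun y => (ℝ ∙ x)ᗮ.orthogonalProjectionOnto y) (gcDist x) hd (by norm_num : (0 : ℝ) < 6)
      hr hr1 (exists_gcDist_le_of_cover Y hY hcov' hx)
    rw [hfin, ← hS] at hmain
    have hpack := card_mul_pow_le Y hY hr hr1 fun y hy y' hy' hne =>
      (hsep y hy y' hy' hne).trans (gcDist_le_two_mul_norm_sub (hY y hy) (hY y' hy'))
    have hS0 : 0 ≤ 1 / (Y.card : ℝ) * S := hpin.le.trans htriv
    have hcS : c * Real.log (1 / r) ≤ 1 / (Y.card : ℝ) * S := by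
      rw [hc, div_mul_eq_mul_div, div_le_iff₀ (by positivity)]
      calc n * Real.log (1 / r) ≤ 6 ^ n * r ^ n * S := hmain
        _ = 1 / (Y.card : ℝ) * S * (6 ^ n * (Y.card * r ^ n)) := by field_simp
        _ ≤ _ := by gcongr
    nlinarith [mul_le_mul_of_nonneg_right hC2 hL, mul_le_mul_of_nonneg_left hlogpi hC0.le]
  · have hL : Real.log (1 / r) ≤ 0 :=
      Real.log_nonpos (by positivity) (by rwa [div_le_iff₀ hr, one_mul])
    nlinarith [mul_nonneg hC0.le (neg_nonneg.2 hL), mul_le_mul_of_nonneg_left hlogpi hC0.le]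
end

section
/- Let n ≥ 2 and let y_1, …, y_m ∈ 𝕊^n be m distinct points containing no antipodal pair (i.e. y_i ≠ -y_j for all i, j). Then for σ-almost every x ∈ 𝕊^n, the real numbers π, d(x,y_1), …, d(x,y_m) are linearly independent over ℚ (no nontrivial rational linear combination of them vanishes). -/
open MeasureTheory

/-- The uniform surface measure on `𝕊^n`: the `n`-dimensional Hausdorff measure
restricted to the unit sphere. -/
noncomputable def sphereMeasure (n : ℕ) : Measure (EuclideanSpace ℝ (Fin (n + 1))) :=
  (μH[(n : ℝ)]).restrict (unitSphere n)


open Filter Topology Module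
open scoped ContDiff RealInnerProductSpace

/-- A real-analytic function on the line that is not identically zero is almost everywhere
nonzero. -/
theorem AnalyticOnNhd.ae_ne_zero {f : ℝ → ℝ} (hf : AnalyticOnNhd ℝ f Set.univ)
    (h : ∃ t, f t ≠ 0) : ∀ᵐ t : ℝ, f t ≠ 0 := by
  obtain ⟨t₀, ht₀⟩ := h
  have h1 : f ⁻¹' {0}ᶜ ∈ codiscrete ℝ := hf.preimage_zero_mem_codiscrete ht₀
  have h2 := ae_restrict_le_codiscreteWithin (μ := (volume : Measure ℝ)) MeasurableSet.univ h1
  rw [Measure.restrict_univ] at h2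
  filter_upwards [h2] with t ht using ht

/-- A measurable set that meets almost every ray from the origin in a null set of parameters
is null. -/
theorem MeasureTheory.Measure.addHaar_eq_zero_of_ae_ray {E : Type*} [NormedAddCommGroup E]
    [NormedSpace ℝ E] [FiniteDimensional ℝ E] [MeasurableSpace E] [BorelSpace E]
    (μ : Measure E) [μ.IsAddHaarMeasure] {Z : Set E} (hZ : MeasurableSet Z)
    (h : ∀ᵐ w ∂μ, ∀ᵐ t : ℝ, 0 < t → t • w ∉ Z) : μ Z = 0 := by
  have hmeas : MeasurableSet {p : E × ℝ | 0 < p.2 → p.2 • p.1 ∉ Z} :=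
    (measurableSet_lt measurable_const measurable_snd).imp
      ((measurable_snd.smul measurable_fst) hZ).compl
  have h' : ∀ᵐ t : ℝ, ∀ᵐ w ∂μ, 0 < t → t • w ∉ Z :=
    (Measure.ae_ae_comm (p := fun w (t : ℝ) => 0 < t → t • w ∉ Z) hmeas).1 h
  obtain ⟨t, ht, htpos⟩ : ∃ t : ℝ, (∀ᵐ w ∂μ, 0 < t → t • w ∉ Z) ∧ 0 < t := by
    by_contra! hcon
    have h0 : volume (Set.Ioi (0 : ℝ)) = 0 :=
      measure_mono_null (fun t (ht : 0 < t) hall => (hcon t hall).not_gt ht) h'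
    simp at h0
  have hnull : μ ((t • ·) ⁻¹' Z) = 0 := by
    exact measure_mono_null (fun w (hw : t • w ∈ Z) (hnot : 0 < t → t • w ∉ Z) => hnot htpos hw) ht
  rw [Measure.addHaar_preimage_smul μ htpos.ne'] at hnull
  refine (mul_eq_zero.1 hnull).resolve_left ?_
  simp [htpos.ne', abs_pos]

/-- Images of Hausdorff-null sets under `C^1` maps are Hausdorff-null. -/
theorem ContDiff.hausdorffMeasure_image_eq_zero {E F : Type*} [NormedAddCommGroup E]
    [NormedSpace ℝ E] [SecondCountableTopology E] [MeasurableSpace E] [BorelSpace E]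
    [NormedAddCommGroup F] [NormedSpace ℝ F] [MeasurableSpace F] [BorelSpace F]
    {f : E → F} (hf : ContDiff ℝ 1 f) {d : ℝ} (hd : 0 ≤ d) {s : Set E} (hs : μH[d] s = 0) :
    μH[d] (f '' s) = 0 := by
  choose K t ht hK using fun x => (hf.contDiffAt (x := x)).exists_lipschitzOnWith
  obtain ⟨c, hc, hcov⟩ := TopologicalSpace.countable_cover_nhds ht
  have hsub : f '' s ⊆ ⋃ x ∈ c, f '' (s ∩ t x) := by
    rintro _ ⟨x, hx, rfl⟩
    obtain ⟨z, hz, hxz⟩ := Set.mem_iUnion₂.1 (hcov.symm ▸ Set.mem_univ x)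
    exact Set.mem_iUnion₂.2 ⟨z, hz, x, ⟨hx, hxz⟩, rfl⟩
  refine measure_mono_null hsub ((measure_biUnion_null_iff hc).2 fun x _ => ?_)
  refine le_antisymm ?_ zero_le
  calc μH[d] (f '' (s ∩ t x))
      ≤ (K x : ENNReal) ^ d * μH[d] (s ∩ t x) :=
        ((hK x).mono Set.inter_subset_right).hausdorffMeasure_image_le hd
    _ = 0 := by rw [measure_mono_null Set.inter_subset_left hs, mul_zero]

section Stereographic

variable {V : Type*} [NormedAddCommGroup V] [InnerProductSpace ℝ V]

/-- A property holding almost everywhere in stereographic coordinates holds almost everywhere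
on the sphere. -/
theorem ae_sphere_of_ae_stereoInvFunAux [FiniteDimensional ℝ V] [MeasurableSpace V] [BorelSpace V]
    {v : V} (hv : ‖v‖ = 1) {d : ℝ} (hd : 0 < d) {P : V → Prop}
    (h : ∀ᵐ w : (ℝ ∙ v)ᗮ ∂μH[d], P (stereoInvFunAux v w)) :
    ∀ᵐ x ∂(μH[d]).restrict (Metric.sphere (0 : V) 1), P x := by
  rw [ae_restrict_iff' Metric.isClosed_sphere.measurableSet]
  have := Measure.nullSingletonClass_hausdorff V hd
  have hf : ContDiff ℝ 1 fun w : (ℝ ∙ v)ᗮ => stereoInvFunAux v w :=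
    contDiff_stereoInvFunAux.comp (ℝ ∙ v)ᗮ.subtypeL.contDiff
  have himg := hf.hausdorffMeasure_image_eq_zero hd.le h
  refine measure_mono_null ?_ (measure_union_null himg (measure_singleton v))
  intro x hx
  simp only [Set.mem_compl_iff, Set.mem_ofPred_eq, Classical.not_imp] at hx
  by_cases hxv : x = v
  · exact Or.inr hxv
  · have hinv : stereoInvFunAux v (stereoToFun v x) = x :=
      congrArg Subtype.val (stereo_left_inv hv (x := ⟨x, hx.1⟩) hxv)
    exact Or.inl ⟨stereoToFun v x, fun hP => hx.2 (hinv ▸ hP), hinv⟩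

theorem inner_stereoInvFunAux_smul (v w y : V) (t : ℝ) :
    ⟪stereoInvFunAux v (t • w), y⟫ =
      (4 * t * ⟪w, y⟫ + (t ^ 2 * ‖w‖ ^ 2 - 4) * ⟪v, y⟫) / (t ^ 2 * ‖w‖ ^ 2 + 4) := by
  rw [stereoInvFunAux_apply, inner_smul_left, inner_add_left, inner_smul_left, inner_smul_left,
    inner_smul_left, norm_smul, mul_pow, Real.norm_eq_abs, sq_abs]
  simp only [conj_trivial]
  ring

/-- Along a line through the origin, inverse stereographic projection tends to the pole. -/
theorem tendsto_inner_stereoInvFunAux_smul {v w : V} (hw : w ≠ 0) (y : V) {l : Filter ℝ}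
    (hl : Tendsto (fun t : ℝ => t⁻¹) l (𝓝 0)) (hl0 : ∀ᶠ t in l, t ≠ 0) :
    Tendsto (fun t : ℝ => ⟪stereoInvFunAux v (t • w), y⟫) l (𝓝 ⟪v, y⟫) := by
  have hw' : 0 < ‖w‖ := norm_pos_iff.2 hw
  set g : ℝ → ℝ := fun s =>
    (4 * s * ⟪w, y⟫ + (‖w‖ ^ 2 - 4 * s ^ 2) * ⟪v, y⟫) / (‖w‖ ^ 2 + 4 * s ^ 2) with hg
  have hcont : Continuous g := by
    refine Continuous.div (by fun_prop) (by fun_prop) fun s => ?_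
    positivity
  have hg0 : g 0 = ⟪v, y⟫ := by
    simp only [hg]
    field_simp
    ring
  have hlim := (hcont.tendsto 0).comp hl
  rw [hg0] at hlim
  refine hlim.congr' ?_
  filter_upwards [hl0] with t ht
  rw [inner_stereoInvFunAux_smul]
  simp only [hg, Function.comp]
  field_simp

/-- The angle to the south pole of a point on a ray through the origin, in stereographic
coordinates. -/
theorem arccos_inner_stereoInvFunAux_smul {v w : V} (hv : ‖v‖ = 1) (hw : ⟪w, v⟫ = 0) {t : ℝ}
    (ht : 0 ≤ t) :
    Real.arccos ⟪stereoInvFunAux v (t • w), -v⟫ = 2 * Real.arctan (t * ‖w‖ / 2) := by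
  have hs : 0 ≤ t * ‖w‖ / 2 := by positivity
  have h1 : 0 ≤ 2 * Real.arctan (t * ‖w‖ / 2) := by
    have := Real.arctan_nonneg.2 hs
    positivity
  have h2 : 2 * Real.arctan (t * ‖w‖ / 2) ≤ Real.pi := by
    linarith [Real.arctan_lt_pi_div_two (t * ‖w‖ / 2)]
  rw [← Real.arccos_cos h1 h2, Real.cos_two_mul, Real.cos_sq_arctan, inner_stereoInvFunAux_smul,
    inner_neg_right, inner_neg_right, hw, real_inner_self_eq_norm_sq, hv]
  congr 1
  field_simp
  ring

/-- Outside the line spanned by the projection of `y`, the great circle through `±v` in the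
direction `w` avoids `±y`. -/
theorem stereoInvFunAux_smul_ne {v y : V} (hy : y ≠ -v) {w : (ℝ ∙ v)ᗮ}
    (hw : w ∉ ℝ ∙ ((ℝ ∙ v)ᗮ.orthogonalProjectionOnto y)) (t : ℝ) :
    stereoInvFunAux v (t • (w : V)) ≠ y := by
  rintro h
  rcases eq_or_ne t 0 with rfl | ht
  · apply hy
    rw [← h]
    simp [smul_smul]
  · apply hw
    have hP := congrArg (ℝ ∙ v)ᗮ.orthogonalProjectionOnto h
    have hv0 : (ℝ ∙ v)ᗮ.orthogonalProjectionOnto v = 0 :=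
      Submodule.orthogonalProjectionOnto_orthogonalComplement_singleton_eq_zero v
    rw [stereoInvFunAux_apply, map_smul, map_add, map_smul, map_smul, map_smul, hv0, smul_zero,
      add_zero, Submodule.orthogonalProjectionOnto_mem_subspace_eq_self, smul_smul, smul_smul] at hP
    rw [Submodule.mem_span_singleton, ← hP]
    refine ⟨((‖t • (w : V)‖ ^ 2 + 4)⁻¹ * 4 * t)⁻¹, ?_⟩
    rw [smul_smul, inv_mul_cancel₀ (by positivity), one_smul]

theorem analyticAt_arccos_inner_stereoInvFunAux {v y : V} (hv : ‖v‖ = 1) (hy : ‖y‖ = 1)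
    (hyv : y ≠ v) (hyv' : y ≠ -v) {w : (ℝ ∙ v)ᗮ}
    (hw : w ∉ ℝ ∙ ((ℝ ∙ v)ᗮ.orthogonalProjectionOnto y)) (t : ℝ) :
    AnalyticAt ℝ (fun t : ℝ => Real.arccos ⟪stereoInvFunAux v (t • (w : V)), y⟫) t := by
  have hnorm : ‖stereoInvFunAux v (t • (w : V))‖ = 1 := by
    simpa using stereoInvFunAux_mem hv ((ℝ ∙ v)ᗮ.smul_mem t w.2)
  have h1 : ⟪stereoInvFunAux v (t • (w : V)), y⟫ ≠ 1 := by
    rw [Ne, inner_eq_one_iff_of_norm_eq_one hnorm hy]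
    exact stereoInvFunAux_smul_ne hyv' hw t
  have h2 : ⟪stereoInvFunAux v (t • (w : V)), y⟫ ≠ -1 := by
    rw [Ne, inner_eq_neg_one_iff_of_norm_eq_one hnorm hy]
    refine stereoInvFunAux_smul_ne (fun h => hyv (neg_injective h)) ?_ t
    rw [map_neg, Submodule.mem_span_singleton]
    rintro ⟨r, rfl⟩
    exact hw (Submodule.mem_span_singleton.2 ⟨-r, by simp⟩)
  have hline : ContDiff ℝ ω fun t : ℝ => ⟪stereoInvFunAux v (t • (w : V)), y⟫ :=
    (contDiff_stereoInvFunAux.comp (contDiff_id.smul contDiff_const)).inner ℝ contDiff_const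
  exact ((Real.contDiffAt_arccos h2 h1).comp t hline.contDiffAt).analyticAt

/-- On almost every ray issuing from the south pole, a combination of a constant and spherical
distances with nonzero coefficient at that pole vanishes only on a null set. -/
theorem ae_combination_ne_zero_on_ray {ι : Type*} (s : Finset ι) {v : V} (hv : ‖v‖ = 1)
    (y : ι → V) (hy : ∀ j ∈ s, ‖y j‖ = 1) (hyv : ∀ j ∈ s, y j ≠ v) (hyv' : ∀ j ∈ s, y j ≠ -v)
    {a : ℝ} (ha : a ≠ 0) (b : ℝ) (c : ι → ℝ) {w : (ℝ ∙ v)ᗮ} (hw0 : w ≠ 0)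
    (hw : ∀ j ∈ s, w ∉ ℝ ∙ ((ℝ ∙ v)ᗮ.orthogonalProjectionOnto (y j))) :
    ∀ᵐ t : ℝ, 0 < t → b + a * Real.arccos ⟪stereoInvFunAux v (t • (w : V)), -v⟫ +
      ∑ j ∈ s, c j * Real.arccos ⟪stereoInvFunAux v (t • (w : V)), y j⟫ ≠ 0 := by
  have hw0' : (w : V) ≠ 0 := by simpa using hw0
  have hwpos : 0 < ‖(w : V)‖ := norm_pos_iff.2 hw0'
  set k : ℝ → ℝ := fun t => b + a * (2 * Real.arctan (t * ‖(w : V)‖ / 2)) +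
      ∑ j ∈ s, c j * Real.arccos ⟪stereoInvFunAux v (t • (w : V)), y j⟫ with hk
  have hk_an : AnalyticOnNhd ℝ k Set.univ := by
    intro t _
    refine AnalyticAt.add (analyticAt_const.add (analyticAt_const.mul ?_)) ?_
    · exact (contDiff_const.mul (Real.contDiff_arctan.comp
        ((contDiff_id.mul contDiff_const).div_const 2))).contDiffAt.analyticAt
    · refine Finset.analyticAt_fun_sum _ fun j hj => analyticAt_const.mul ?_
      exact analyticAt_arccos_inner_stereoInvFunAux hv (hy j hj) (hyv j hj) (hyv' j hj) (hw j hj) t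
  have hk_lim : ∀ {l : Filter ℝ} {L : ℝ}, Tendsto (fun t : ℝ => t⁻¹) l (𝓝 0) →
      (∀ᶠ t in l, t ≠ 0) →
      Tendsto (fun t => Real.arctan (t * ‖(w : V)‖ / 2)) l (𝓝 L) →
      Tendsto k l (𝓝 (b + a * (2 * L) + ∑ j ∈ s, c j * Real.arccos ⟪v, y j⟫)) := by
    intro l L hl hl0 hL
    refine ((hL.const_mul 2).const_mul a |>.const_add b).add (tendsto_finsetSum _ fun j _ => ?_)
    exact ((Real.continuous_arccos.tendsto _).comp
      (tendsto_inner_stereoInvFunAux_smul hw0' (y j) hl hl0)).const_mul (c j)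
  have hk_ne : ∃ t, k t ≠ 0 := by
    by_contra! hzero
    have hk0 : k = fun _ => 0 := funext hzero
    have htop := hk_lim tendsto_inv_atTop_zero (eventually_ne_atTop 0)
      ((tendsto_nhds_of_tendsto_nhdsWithin Real.tendsto_arctan_atTop).comp
        ((tendsto_id.atTop_mul_const hwpos).atTop_div_const two_pos))
    have hbot := hk_lim tendsto_inv_atBot_zero (eventually_ne_atBot 0)
      ((tendsto_nhds_of_tendsto_nhdsWithin Real.tendsto_arctan_atBot).comp
        ((tendsto_id.atBot_mul_const hwpos).atBot_div_const two_pos))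
    rw [hk0] at htop hbot
    have e1 := tendsto_nhds_unique htop tendsto_const_nhds
    have e2 := tendsto_nhds_unique hbot tendsto_const_nhds
    exact mul_ne_zero ha Real.pi_ne_zero (by linarith)
  filter_upwards [hk_an.ae_ne_zero hk_ne] with t ht htpos
  rwa [arccos_inner_stereoInvFunAux_smul hv ?_ htpos.le]
  exact Submodule.mem_orthogonal_singleton_iff_inner_left.1 w.2

/-- A combination of a constant and spherical distances is nonzero almost everywhere on the sphere
as soon as the distance to `-v` has a nonzero coefficient and the other points differ from `±v`. -/
theorem ae_sphere_combination_ne_zero [FiniteDimensional ℝ V] [MeasurableSpace V] [BorelSpace V]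
    {n : ℕ} (hn : 2 ≤ n) (hV : finrank ℝ V = n + 1) {ι : Type*} (s : Finset ι) {v : V}
    (hv : ‖v‖ = 1) (y : ι → V) (hy : ∀ j ∈ s, ‖y j‖ = 1) (hyv : ∀ j ∈ s, y j ≠ v)
    (hyv' : ∀ j ∈ s, y j ≠ -v) {a : ℝ} (ha : a ≠ 0) (b : ℝ) (c : ι → ℝ) :
    ∀ᵐ x ∂(μH[(n : ℝ)]).restrict (Metric.sphere (0 : V) 1),
      b + a * Real.arccos ⟪x, -v⟫ + ∑ j ∈ s, c j * Real.arccos ⟪x, y j⟫ ≠ 0 := by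
  have : Fact (finrank ℝ V = n + 1) := ⟨hV⟩
  have hrank : finrank ℝ (ℝ ∙ v)ᗮ = n :=
    Submodule.finrank_orthogonal_span_singleton (by rintro rfl; simp at hv)
  have hHaar : (μH[(n : ℝ)] : Measure (ℝ ∙ v)ᗮ).IsAddHaarMeasure := by
    rw [← hrank]
    infer_instance
  refine ae_sphere_of_ae_stereoInvFunAux hv (by positivity) ?_
  have hspan : ∀ u : (ℝ ∙ v)ᗮ, ∀ᵐ w ∂(μH[(n : ℝ)] : Measure (ℝ ∙ v)ᗮ), w ∉ ℝ ∙ u := by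
    intro u
    refine measure_eq_zero_iff_ae_notMem.1 (Measure.addHaar_submodule _ (ℝ ∙ u) fun htop => ?_)
    have := finrank_span_le_card (R := ℝ) ({u} : Set (ℝ ∙ v)ᗮ)
    rw [htop, finrank_top, hrank, Set.toFinset_singleton, Finset.card_singleton] at this
    omega
  have hcont : Continuous fun w : (ℝ ∙ v)ᗮ => stereoInvFunAux v w :=
    (contDiff_stereoInvFunAux (m := 0)).continuous.comp continuous_subtype_val
  have hG : Continuous fun w : (ℝ ∙ v)ᗮ => b + a * Real.arccos ⟪stereoInvFunAux v w, -v⟫ +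
      ∑ j ∈ s, c j * Real.arccos ⟪stereoInvFunAux v w, y j⟫ := by
    have : ∀ u : V, Continuous fun w : (ℝ ∙ v)ᗮ => Real.arccos ⟪stereoInvFunAux v w, u⟫ :=
      fun u => Real.continuous_arccos.comp (hcont.inner continuous_const)
    exact (continuous_const.add (continuous_const.mul (this _))).add
      (continuous_finsetSum _ fun j _ => continuous_const.mul (this _))
  refine measure_eq_zero_iff_ae_notMem.1 (Measure.addHaar_eq_zero_of_ae_ray _
    (isClosed_eq hG continuous_const).measurableSet ?_)
  filter_upwards [hspan 0, (Finset.eventually_all s).2 fun j _ =>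
    hspan ((ℝ ∙ v)ᗮ.orthogonalProjectionOnto (y j))] with w hw0 hw
  exact ae_combination_ne_zero_on_ray s hv y hy hyv hyv' ha b c (by simpa using hw0) hw

end Stereographic

theorem stmt_8 (n : ℕ) (hn : 2 ≤ n) (m : ℕ)
    (y : Fin m → EuclideanSpace ℝ (Fin (n + 1)))
    (hmem : ∀ j, y j ∈ unitSphere n)
    (hdist : Function.Injective y)
    (hant : ∀ i j, y i ≠ -y j) :
    ∀ᵐ x ∂(sphereMeasure n),
      ∀ (q₀ : ℚ) (q : Fin m → ℚ),
        (q₀ : ℝ) * Real.pi + ∑ j, (q j : ℝ) * gcDist x (y j) = 0 →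
        q₀ = 0 ∧ ∀ j, q j = 0 := by
  have hnorm : ∀ j, ‖y j‖ = 1 := fun j => by simpa [unitSphere] using hmem j
  rw [ae_all_iff]
  intro q₀
  rw [ae_all_iff]
  intro q
  by_cases hq : ∀ j, q j = 0
  · refine ae_of_all _ fun x hx => ⟨?_, hq⟩
    simpa [hq, Real.pi_ne_zero] using hx
  · obtain ⟨i, hi⟩ := not_forall.1 hq
    have hae := ae_sphere_combination_ne_zero hn (by simp) (Finset.univ.erase i)
      (v := -y i) (by rw [norm_neg, hnorm]) y (fun j _ => hnorm j) (fun j _ => hant j i)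
      (fun j hj => by
        rw [neg_neg]
        exact hdist.ne (Finset.ne_of_mem_erase hj))
      (a := (q i : ℝ)) (by exact_mod_cast hi) ((q₀ : ℝ) * Real.pi) (fun j => (q j : ℝ))
    filter_upwards [hae] with x hx hzero
    refine absurd ?_ hx
    rw [neg_neg, add_assoc, ← hzero, ← Finset.add_sum_erase _ _ (Finset.mem_univ i)]
    rfl
end

section
/- Let t_1, …, t_m be real numbers such that the family 2π, t_1, …, t_m is linearly independent over ℚ, let κ_1, …, κ_m be nonnegative real numbers, and let α, β ∈ ℝ. Then limsup_{N→∞, N ∈ ℕ} | Σ_{j=1}^{m} κ_j · cos( (N+α) t_j − β ) | = Σ_{j=1}^{m} κ_j. -/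
open MeasureTheory Filter Topology UnitAddTorus

/-- The Cesàro means of the powers of `z ≠ 1` on the unit circle tend to zero. -/
lemma tendsto_average_pow_of_norm_eq_one {z : ℂ} (hz : ‖z‖ = 1) (hz1 : z ≠ 1) :
    Tendsto (fun N : ℕ ↦ (N : ℂ)⁻¹ * ∑ k ∈ Finset.range N, z ^ k) atTop (𝓝 0) := by
  refine squeeze_zero_norm (a := fun N : ℕ ↦ (N : ℝ)⁻¹ * (2 / ‖z - 1‖)) (fun N ↦ ?_) ?_
  · rw [geom_sum_eq hz1, norm_mul, norm_inv, Complex.norm_natCast, norm_div]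
    gcongr
    exact (norm_sub_le _ _).trans (by rw [norm_pow, hz, one_pow, norm_one]; norm_num)
  · simpa using (tendsto_inv_atTop_nhds_zero_nat (𝕜 := ℝ)).mul_const (2 / ‖z - 1‖)

namespace UnitAddTorus

variable {d : Type*} [Fintype d]

lemma mFourier_apply_add (n : d → ℤ) (x y : UnitAddTorus d) :
    mFourier n (x + y) = mFourier n x * mFourier n y := by
  simp [mFourier, smul_add, AddCircle.toCircle_add, Finset.prod_mul_distrib]

lemma mFourier_apply_nsmul (n : d → ℤ) (k : ℕ) (x : UnitAddTorus d) :
    mFourier n (k • x) = mFourier n x ^ k := by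
  induction k with
  | zero => simp [mFourier]
  | succ k ih => rw [succ_nsmul, mFourier_apply_add, ih, pow_succ]

lemma norm_mFourier_apply (n : d → ℤ) (x : UnitAddTorus d) : ‖mFourier n x‖ = 1 := by
  simp only [mFourier, ContinuousMap.coe_mk, norm_prod, fourier_apply, Circle.norm_coe,
    Finset.prod_const_one]

/-- A nontrivial character has zero integral against a translation-invariant measure. -/
lemma integral_mFourier_eq_zero (μ : Measure (UnitAddTorus d)) [μ.IsAddLeftInvariant]
    {n : d → ℤ} {x : UnitAddTorus d} (hx : mFourier n x ≠ 1) : ∫ y, mFourier n y ∂μ = 0 := by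
  have h := integral_add_left_eq_self (μ := μ) (fun y ↦ mFourier n y) x
  simp_rw [mFourier_apply_add, integral_const_mul] at h
  have : (mFourier n x - 1) * ∫ y, mFourier n y ∂μ = 0 := by rw [sub_mul, h, one_mul, sub_self]
  exact (mul_eq_zero.1 this).resolve_left (sub_ne_zero.2 hx)

/-- Weyl's criterion for trigonometric polynomials. -/
lemma tendsto_average_of_mem_span (μ : Measure (UnitAddTorus d)) [μ.IsAddLeftInvariant]
    [IsProbabilityMeasure μ] {x : UnitAddTorus d} (hx : ∀ n : d → ℤ, n ≠ 0 → mFourier n x ≠ 1)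
    {P : C(UnitAddTorus d, ℂ)} (hP : P ∈ Submodule.span ℂ (Set.range (mFourier (d := d)))) :
    Tendsto (fun N : ℕ ↦ (N : ℂ)⁻¹ * ∑ k ∈ Finset.range N, P (k • x)) atTop
      (𝓝 (∫ y, P y ∂μ)) := by
  have hint (P : C(UnitAddTorus d, ℂ)) : Integrable P μ :=
    P.continuous.integrable_of_hasCompactSupport (HasCompactSupport.of_compactSpace _)
  induction hP using Submodule.span_induction with
  | mem P h =>
    obtain ⟨n, rfl⟩ := h
    by_cases hn : n = 0
    · subst hn
      simp only [mFourier_zero, ContinuousMap.one_apply, integral_const, probReal_univ, one_smul,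
        Finset.sum_const, Finset.card_range, nsmul_eq_mul, mul_one]
      refine tendsto_const_nhds.congr' ?_
      filter_upwards [eventually_ne_atTop 0] with N hN
      rw [inv_mul_cancel₀ (Nat.cast_ne_zero.2 hN)]
    · simp_rw [mFourier_apply_nsmul, integral_mFourier_eq_zero μ (hx n hn)]
      exact tendsto_average_pow_of_norm_eq_one (norm_mFourier_apply n x) (hx n hn)
  | zero => simp
  | add P Q _ _ hP hQ =>
    simp only [ContinuousMap.add_apply, Finset.sum_add_distrib, mul_add]
    rw [integral_add (hint P) (hint Q)]
    exact hP.add hQ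
  | smul c P _ hP =>
    simp only [ContinuousMap.smul_apply, smul_eq_mul, ← Finset.mul_sum, integral_const_mul]
    simpa only [mul_left_comm] using hP.const_mul c

/-- **Weyl's equidistribution theorem** on the torus. -/
theorem tendsto_average (μ : Measure (UnitAddTorus d)) [μ.IsAddLeftInvariant]
    [IsProbabilityMeasure μ] {x : UnitAddTorus d} (hx : ∀ n : d → ℤ, n ≠ 0 → mFourier n x ≠ 1)
    (f : C(UnitAddTorus d, ℂ)) :
    Tendsto (fun N : ℕ ↦ (N : ℂ)⁻¹ * ∑ k ∈ Finset.range N, f (k • x)) atTop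
      (𝓝 (∫ y, f y ∂μ)) := by
  have hint (P : C(UnitAddTorus d, ℂ)) : Integrable P μ :=
    P.continuous.integrable_of_hasCompactSupport (HasCompactSupport.of_compactSpace _)
  rw [Metric.tendsto_nhds]
  intro ε hε
  have hf : f ∈ (Submodule.span ℂ (Set.range (mFourier (d := d)))).topologicalClosure := by
    rw [span_mFourier_closure_eq_top]
    trivial
  obtain ⟨P, hP, hfP⟩ := Metric.mem_closure_iff.1 hf (ε / 3) (by positivity)
  have hle (y) : ‖f y - P y‖ ≤ ε / 3 := by
    rw [← dist_eq_norm]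
    exact (ContinuousMap.dist_apply_le_dist y).trans hfP.le
  have hI : ‖∫ y, f y ∂μ - ∫ y, P y ∂μ‖ ≤ ε / 3 := by
    rw [← integral_sub (hint f) (hint P)]
    simpa using norm_integral_le_of_norm_le_const (μ := μ) (.of_forall hle)
  filter_upwards [Metric.tendsto_nhds.1 (tendsto_average_of_mem_span μ hx hP) (ε / 3)
    (by positivity)] with N hN
  have hA : ‖(N : ℂ)⁻¹ * ∑ k ∈ Finset.range N, f (k • x) -
      (N : ℂ)⁻¹ * ∑ k ∈ Finset.range N, P (k • x)‖ ≤ ε / 3 := by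
    rw [← mul_sub, ← Finset.sum_sub_distrib, norm_mul, norm_inv, Complex.norm_natCast]
    refine (mul_le_mul_of_nonneg_left (norm_sum_le_of_le _ fun k _ ↦ hle (k • x))
      (by positivity)).trans ?_
    rw [Finset.sum_const, Finset.card_range, nsmul_eq_mul, ← mul_assoc]
    exact mul_le_of_le_one_left (by positivity) inv_mul_le_one
  rw [← dist_eq_norm] at hA hI
  rw [dist_comm] at hI
  linarith [dist_triangle4 ((N : ℂ)⁻¹ * ∑ k ∈ Finset.range N, f (k • x))
    ((N : ℂ)⁻¹ * ∑ k ∈ Finset.range N, P (k • x)) (∫ y, P y ∂μ) (∫ y, f y ∂μ)]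

/-- **Kronecker's theorem**: if no nontrivial character is trivial at `x`, then the multiples of
`x` accumulate at every point of the torus. -/
theorem mapClusterPt_nsmul {x : UnitAddTorus d} (hx : ∀ n : d → ℤ, n ≠ 0 → mFourier n x ≠ 1)
    (y : UnitAddTorus d) : MapClusterPt y atTop (fun k : ℕ ↦ k • x) := by
  let μ : Measure (UnitAddTorus d) := Measure.addHaarMeasure ⊤
  have : IsProbabilityMeasure μ := ⟨Measure.addHaarMeasure_self⟩
  rw [mapClusterPt_iff_frequently]
  intro U hU
  obtain ⟨ε, hε, hεU⟩ := Metric.mem_nhds_iff.1 hU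
  let g : UnitAddTorus d → ℝ := fun z ↦ max 0 (ε - dist z y)
  have hg : Continuous g := by fun_prop
  have hpos : 0 < ∫ z, g z ∂μ :=
    hg.integral_pos_of_hasCompactSupport_nonneg_nonzero (x := y)
      (HasCompactSupport.of_compactSpace _) (fun z ↦ le_max_left _ _)
      (by simp [g, hε.le, hε.ne'])
  by_contra h
  rw [not_frequently, eventually_atTop] at h
  obtain ⟨M, hM⟩ := h
  have hzero (k : ℕ) (hk : M ≤ k) : g (k • x) = 0 := by
    refine max_eq_left (sub_nonpos.2 ?_)
    by_contra! hlt
    exact hM k hk (hεU hlt)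
  have hlim := tendsto_average μ hx ⟨fun z ↦ (g z : ℂ), by fun_prop⟩
  have hlim0 : Tendsto (fun N : ℕ ↦ (N : ℂ)⁻¹ * ∑ k ∈ Finset.range N, (g (k • x) : ℂ)) atTop
      (𝓝 0) := by
    have h0 := (tendsto_inv_atTop_nhds_zero_nat (𝕜 := ℂ)).mul_const
      (∑ k ∈ Finset.range M, (g (k • x) : ℂ))
    rw [zero_mul] at h0
    refine h0.congr' ?_
    filter_upwards [eventually_ge_atTop M] with N hN
    congr 1
    refine Finset.sum_subset (Finset.range_mono hN) fun k _ hk ↦ ?_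
    rw [hzero k (by simpa using hk), Complex.ofReal_zero]
  have := tendsto_nhds_unique hlim hlim0
  simp only [ContinuousMap.coe_mk, integral_complex_ofReal, Complex.ofReal_eq_zero] at this
  exact hpos.ne' this

lemma mFourier_coe (n : d → ℤ) (s : d → ℝ) :
    mFourier n (fun j ↦ (s j : UnitAddCircle)) =
      Complex.exp (2 * Real.pi * Complex.I * ∑ j, n j * s j) := by
  rw [Complex.ofReal_sum, Finset.mul_sum, Complex.exp_sum]
  simp only [mFourier, ContinuousMap.coe_mk, fourier_coe_apply]
  simp [mul_assoc]

end UnitAddTorus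

theorem stmt_10 (m : ℕ) (t : Fin m → ℝ)
    (hind : ∀ (q₀ : ℚ) (q : Fin m → ℚ),
      (q₀ : ℝ) * (2 * Real.pi) + ∑ j, (q j : ℝ) * t j = 0 → q₀ = 0 ∧ ∀ j, q j = 0)
    (κ : Fin m → ℝ) (hκ : ∀ j, 0 ≤ κ j) (α β : ℝ) :
    Filter.limsup (fun N : ℕ => |∑ j, κ j * Real.cos (((N : ℝ) + α) * t j - β)|)
      Filter.atTop = ∑ j, κ j := by
  have hπ : (2 * Real.pi) ≠ 0 := by positivity
  let x : UnitAddTorus (Fin m) := fun j ↦ ((t j / (2 * Real.pi) : ℝ) : UnitAddCircle)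
  let c : UnitAddTorus (Fin m) := fun j ↦ (((α * t j - β) / (2 * Real.pi) : ℝ) : UnitAddCircle)
  have hx (n : Fin m → ℤ) (hn : n ≠ 0) : mFourier n x ≠ 1 := by
    intro h
    rw [mFourier_coe, Complex.exp_eq_one_iff] at h
    obtain ⟨k, hk⟩ := h
    have hk' : ∑ j, (n j : ℝ) * (t j / (2 * Real.pi)) = k := by
      have h2 : (2 * Real.pi * Complex.I : ℂ) ≠ 0 := Complex.two_pi_I_ne_zero
      rw [mul_comm (k : ℂ)] at hk
      exact_mod_cast mul_left_cancel₀ h2 hk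
    refine hn (funext fun j ↦ ?_)
    have := (hind (-k) (fun j ↦ n j) ?_).2 j
    · exact_mod_cast this
    · push_cast
      rw [← hk', neg_mul, Finset.sum_mul, neg_add_eq_zero]
      refine Finset.sum_congr rfl fun j _ ↦ ?_
      field_simp
  let H : UnitAddTorus (Fin m) → ℝ := fun y ↦ ∑ j, κ j * (fourier 1 (y j + c j)).re
  have hH : Continuous H := by fun_prop
  have hHN (N : ℕ) : H (N • x) = ∑ j, κ j * Real.cos (((N : ℝ) + α) * t j - β) := by
    refine Finset.sum_congr rfl fun j _ ↦ ?_
    have : (N • x) j + c j =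
        (((((N : ℝ) + α) * t j - β) / (2 * Real.pi) : ℝ) : UnitAddCircle) := by
      simp only [Pi.smul_apply, x, c, ← AddCircle.coe_nsmul, ← AddCircle.coe_add]
      congr 1
      rw [nsmul_eq_mul]
      ring
    rw [this, fourier_one, AddCircle.toCircle_apply_mk, Circle.coe_exp, Complex.exp_ofReal_mul_I_re,
      div_one, mul_div_cancel₀ _ hπ]
  have hbound (N : ℕ) : |∑ j, κ j * Real.cos (((N : ℝ) + α) * t j - β)| ≤ ∑ j, κ j := by
    refine (Finset.abs_sum_le_sum_abs _ _).trans (Finset.sum_le_sum fun j _ ↦ ?_)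
    rw [abs_mul, abs_of_nonneg (hκ j)]
    exact mul_le_of_le_one_right (hκ j) (Real.abs_cos_le_one _)
  refine le_antisymm (limsup_le_of_le ?_ (.of_forall hbound)) (le_of_forall_lt fun b hb ↦ ?_)
  · exact IsBoundedUnder.isCoboundedUnder_le
      (isBoundedUnder_of ⟨0, fun N ↦ abs_nonneg _⟩)
  · obtain ⟨b', hbb', hb'⟩ := exists_between hb
    refine hbb'.trans_le (le_limsup_of_frequently_le ?_ (isBoundedUnder_of ⟨_, hbound⟩))
    have hmem : {y | b' < H y} ∈ 𝓝 (-c) := by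
      refine (isOpen_lt continuous_const hH).mem_nhds ?_
      simpa [H] using hb'
    refine ((mapClusterPt_nsmul hx (-c)).frequently hmem).mono fun N hN ↦ ?_
    exact (hHN N ▸ (hN : b' < H (N • x))).le.trans (le_abs_self _)
end

section
/- (Ingham) Let δ > 0 and set m = ⌈δ⌉ + 1. Then there exist real polynomials p_0, …, p_m and a constant C > 0 such that for all 0 < ε ≤ 1 and all k ∈ ℕ, | (k+ε)^δ − Σ_{j=0}^{m} p_j(ε) · A^δ_{k-j} | ≤ C · (k+1)^{-2}, where A^δ_k = Γ(k+δ+1)/(Γ(k+1)·Γ(δ+1)) for k ≥ 0 and A^δ_k = 0 for k < 0. -/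
/-- The generalized binomial coefficient `A_k^δ` extended by `0` for negative integers `k`. -/
noncomputable def cesaroAZ (δ : ℝ) (k : ℤ) : ℝ :=
  if k < 0 then 0 else cesaroA δ k.toNat

section CesaroExpansion

open Filter Topology Asymptotics

lemma AnalyticAt.exists_eq_add_mul {f : ℝ → ℝ} (hf : AnalyticAt ℝ f 0) :
    ∃ g : ℝ → ℝ, AnalyticAt ℝ g 0 ∧ g 0 = deriv f 0 ∧ ∀ x, f x = f 0 + x * g x := by
  obtain ⟨p, hp⟩ := hf
  refine ⟨dslope f 0, ⟨_, hp.has_fpower_series_dslope_fslope⟩, dslope_same f 0, fun x => ?_⟩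
  have := sub_smul_dslope f 0 x
  simp only [sub_zero, smul_eq_mul] at this
  linarith

lemma exists_polynomial_difference {l : ℝ → ℝ} (hl : AnalyticAt ℝ l 0) (h0 : l 0 = 0)
    (h1 : deriv l 0 = 0) (n : ℕ) :
    ∃ (P : Polynomial ℝ) (g : ℝ → ℝ), AnalyticAt ℝ g 0 ∧
      ∀ᶠ x in 𝓝 (0 : ℝ), l x = P.eval (x / (1 + x)) - P.eval x + x ^ (n + 2) * g x := by
  induction n with
  | zero =>
    obtain ⟨g, hg, hg0, hgl⟩ := hl.exists_eq_add_mul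
    obtain ⟨h, hh, -, hhg⟩ := hg.exists_eq_add_mul
    refine ⟨0, h, hh, Eventually.of_forall fun x => ?_⟩
    rw [hgl x, hhg x, hg0, h0, h1]
    simp
    ring
  | succ n ih =>
    obtain ⟨P, g, hg, hP⟩ := ih
    obtain ⟨g1, hg1, -, hgg⟩ := hg.exists_eq_add_mul
    have hu : HasDerivAt (fun x : ℝ => ((1 + x) ^ (n + 1))⁻¹) (-(n + 1 : ℝ)) 0 := by
      have h := (((hasDerivAt_id (0 : ℝ)).const_add 1).pow (n + 1)).inv (by simp)
      exact h.congr_deriv (by simp)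
    have hua : AnalyticAt ℝ (fun x : ℝ => ((1 + x) ^ (n + 1))⁻¹) 0 := by
      refine AnalyticAt.inv (by fun_prop) (by simp)
    obtain ⟨v, hv, hv0, huv⟩ := hua.exists_eq_add_mul
    obtain ⟨w, hw, -, hvw⟩ := hv.exists_eq_add_mul
    rw [hu.deriv] at hv0
    have hn : (n + 1 : ℝ) ≠ 0 := by positivity
    refine ⟨P + Polynomial.C (-(g 0 / (n + 1))) * Polynomial.X ^ (n + 1),
      fun x => g1 x + (g 0 / (n + 1)) * w x, by fun_prop, ?_⟩
    filter_upwards [hP, lt_mem_nhds (show (-1 : ℝ) < 0 by norm_num)] with x hx hx1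
    have hx2 : 1 + x ≠ 0 := by linarith
    have e := huv x
    rw [hvw x, hv0] at e
    simp only [add_zero, one_pow, inv_one] at e
    rw [hx, hgg x]
    simp only [Polynomial.eval_add, Polynomial.eval_mul, Polynomial.eval_C, Polynomial.eval_pow,
      Polynomial.eval_X, div_pow]
    rw [div_eq_mul_inv (x ^ (n + 1)), e]
    field_simp
    ring

lemma AnalyticAt.isBigO_one_inv_nat {g : ℝ → ℝ} (hg : AnalyticAt ℝ g 0) :
    (fun k : ℕ => g ((k : ℝ)⁻¹)) =O[atTop] fun _ => (1 : ℝ) :=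
  (hg.continuousAt.tendsto.comp tendsto_inv_atTop_nhds_zero_nat).isBigO_one ℝ

lemma exists_tendsto_isBigO_of_sub_isBigO {b : ℕ → ℝ} (n : ℕ)
    (hb : (fun k => b (k + 1) - b k) =O[atTop] fun k : ℕ => ((k : ℝ)⁻¹) ^ (n + 2)) :
    ∃ L : ℝ, (fun k => b k - L) =O[atTop] fun k : ℕ => ((k : ℝ)⁻¹) ^ n := by
  obtain ⟨C, hC, hCb⟩ := hb.exists_pos
  obtain ⟨K, hK⟩ := eventually_atTop.1 hCb.bound
  have hs : Summable fun k : ℕ => ((k : ℝ)⁻¹) ^ 2 := by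
    simp
  set S := ∑' k : ℕ, ((k : ℝ)⁻¹) ^ 2
  have key : ∀ k ≥ max K 1, ∀ r : ℕ,
      dist (b (r + k)) (b (r.succ + k)) ≤ C * ((k : ℝ)⁻¹) ^ n * (((r + k : ℕ) : ℝ)⁻¹) ^ 2 := by
    intro k hk r
    have hk1 : 1 ≤ k := (le_max_right _ _).trans hk
    have hk0 : (0 : ℝ) < k := by exact_mod_cast hk1
    have h := hK (r + k) (by have := (le_max_left K 1).trans hk; omega)
    rw [dist_comm, Real.dist_eq, ← Real.norm_eq_abs, show r.succ + k = r + k + 1 by omega]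
    refine h.trans ?_
    rw [Real.norm_of_nonneg (by positivity), pow_add, ← mul_assoc]
    gcongr
    simp
  have hs' : ∀ k : ℕ, Summable fun r : ℕ => C * ((k : ℝ)⁻¹) ^ n * (((r + k : ℕ) : ℝ)⁻¹) ^ 2 :=
    fun k => ((summable_nat_add_iff k).2 hs).mul_left _
  have hcau : CauchySeq fun r => b (r + max K 1) :=
    cauchySeq_of_dist_le_of_summable _ (key _ le_rfl) (hs' _)
  obtain ⟨L, hL⟩ := cauchySeq_tendsto_of_complete hcau
  have hL' : Tendsto b atTop (𝓝 L) := (tendsto_add_atTop_iff_nat _).1 hL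
  refine ⟨L, IsBigO.of_bound (C * S) ?_⟩
  filter_upwards [eventually_ge_atTop (max K 1)] with k hk
  have h := dist_le_tsum_of_dist_le_of_tendsto₀ _ (key k hk) (hs' k)
    ((tendsto_add_atTop_iff_nat k).2 hL')
  rw [Real.dist_eq, zero_add, tsum_mul_left] at h
  rw [Real.norm_eq_abs, Real.norm_of_nonneg (by positivity)]
  refine h.trans ?_
  have : ∑' r : ℕ, (((r + k : ℕ) : ℝ)⁻¹) ^ 2 ≤ S :=
    (((summable_nat_add_iff k).2 hs).tsum_le_tsum_of_inj (fun r => r + k)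
      (fun a b h => by simpa using h) (fun _ _ => by positivity) (fun _ => le_rfl) hs)
  calc C * ((k : ℝ)⁻¹) ^ n * _ ≤ C * ((k : ℝ)⁻¹) ^ n * S := by gcongr
    _ = _ := by ring

lemma exists_polynomial_isBigO_of_sub_eventuallyEq {a : ℕ → ℝ} {l : ℝ → ℝ}
    (hl : AnalyticAt ℝ l 0) (h0 : l 0 = 0) (h1 : deriv l 0 = 0)
    (ha : ∀ᶠ k : ℕ in atTop, a (k + 1) - a k = l ((k : ℝ)⁻¹)) (n : ℕ) :
    ∃ P : Polynomial ℝ,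
      (fun k => a k - P.eval ((k : ℝ)⁻¹)) =O[atTop] fun k : ℕ => ((k : ℝ)⁻¹) ^ n := by
  obtain ⟨P, g, hg, hP⟩ := exists_polynomial_difference hl h0 h1 n
  obtain ⟨L, hL⟩ := exists_tendsto_isBigO_of_sub_isBigO
    (b := fun k => a k - P.eval ((k : ℝ)⁻¹)) n (by
      have h := (isBigO_refl (fun k : ℕ => ((k : ℝ)⁻¹) ^ (n + 2)) atTop).mul hg.isBigO_one_inv_nat
      simp only [mul_one] at h
      refine h.congr' ?_ EventuallyEq.rfl
      filter_upwards [ha, tendsto_inv_atTop_nhds_zero_nat.eventually hP, eventually_gt_atTop 0]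
        with k hk hk1 hk0
      have hk0' : (k : ℝ) ≠ 0 := by positivity
      have e : (k : ℝ)⁻¹ / (1 + (k : ℝ)⁻¹) = ((k + 1 : ℕ) : ℝ)⁻¹ := by
        push_cast
        field_simp
      rw [e] at hk1
      linarith)
  refine ⟨P + Polynomial.C L, hL.congr_left fun k => ?_⟩
  simp
  ring

/-- Iterated backward differences of the Cesàro coefficients. -/
noncomputable def cesaroDiff (δ : ℝ) : ℕ → ℤ → ℝ
  | 0 => cesaroAZ δ
  | i + 1 => fun z => cesaroDiff δ i z - cesaroDiff δ i (z - 1)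

/-- The ratio `Γ(k+δ+1-i)/Γ(k+1)`, of order `k ^ (δ - i)`. -/
noncomputable def gammaRatio (δ : ℝ) (i k : ℕ) : ℝ :=
  Real.Gamma (k + δ + 1 - i) / Real.Gamma (k + 1)

/-- The sequences of order `O(k⁻²)`. -/
def invSqBigO : Submodule ℝ (ℕ → ℝ) where
  carrier := {f | f =O[atTop] fun k : ℕ => ((k : ℝ)⁻¹) ^ 2}
  add_mem' := fun hf hg => hf.add hg
  zero_mem' := isBigO_zero _ _
  smul_mem' := fun c _ hf => hf.const_mul_left c

/-- Linear combinations of the shifted Cesàro coefficients `A^δ_{k-j}`, `0 ≤ j ≤ ⌈δ⌉ + 1`,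
up to an error `O(k⁻²)`. -/
noncomputable def cesaroSpan (δ : ℝ) : Submodule ℝ (ℕ → ℝ) :=
  Submodule.span ℝ (Set.range fun (j : Fin (⌈δ⌉₊ + 2)) (k : ℕ) => cesaroAZ δ ((k : ℤ) - (j : ℕ))) ⊔
    invSqBigO

lemma cesaroSpan_of_isBigO {δ : ℝ} {f : ℕ → ℝ} (hf : f =O[atTop] fun k : ℕ => ((k : ℝ)⁻¹) ^ 2) :
    f ∈ cesaroSpan δ :=
  Submodule.mem_sup_right hf

lemma cesaroSpan_of_isBigO_sub {δ : ℝ} {f g : ℕ → ℝ} (hg : g ∈ cesaroSpan δ)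
    (h : (fun k => f k - g k) =O[atTop] fun k : ℕ => ((k : ℝ)⁻¹) ^ 2) : f ∈ cesaroSpan δ := by
  have := add_mem (cesaroSpan_of_isBigO (δ := δ) h) hg
  convert this using 1
  ext k
  simp

lemma cesaroSpan_of_eventuallyEq {δ : ℝ} {f g : ℕ → ℝ} (hg : g ∈ cesaroSpan δ)
    (h : f =ᶠ[atTop] g) : f ∈ cesaroSpan δ := by
  refine cesaroSpan_of_isBigO_sub hg ((isBigO_zero _ _).congr' ?_ EventuallyEq.rfl)
  filter_upwards [h] with k hk
  simp [hk]

lemma exists_of_mem_cesaroSpan {δ : ℝ} {f : ℕ → ℝ} (hf : f ∈ cesaroSpan δ) :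
    ∃ c : Fin (⌈δ⌉₊ + 2) → ℝ,
      (fun k : ℕ => f k - ∑ j, c j * cesaroAZ δ ((k : ℤ) - (j : ℕ))) =O[atTop]
        fun k : ℕ => ((k : ℝ)⁻¹) ^ 2 := by
  obtain ⟨y, hy, z, hz, rfl⟩ := Submodule.mem_sup.1 hf
  obtain ⟨c, rfl⟩ := (Submodule.mem_span_range_iff_exists_fun ℝ).1 hy
  refine ⟨c, IsBigO.congr_left (show z =O[atTop] _ from hz) fun k => ?_⟩
  simp

lemma cesaroDiff_mem_cesaroSpan (δ : ℝ) (i t : ℕ) (h : i + t ≤ ⌈δ⌉₊ + 1) :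
    (fun k : ℕ => cesaroDiff δ i ((k : ℤ) - t)) ∈ cesaroSpan δ := by
  induction i generalizing t with
  | zero =>
    exact Submodule.mem_sup_left (Submodule.subset_span ⟨⟨t, by omega⟩, rfl⟩)
  | succ i ih =>
    convert sub_mem (ih t (by omega)) (ih (t + 1) (by omega)) using 1
    ext k
    simp only [cesaroDiff, Pi.sub_apply]
    push_cast
    rw [sub_sub]

lemma gammaRatio_eq_mul {δ : ℝ} (hδ : 0 < δ) {i k : ℕ} (h : i ≤ k) :
    gammaRatio δ i k = (k + δ - i) * gammaRatio δ (i + 1) k := by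
  have hik : (i : ℝ) ≤ k := by exact_mod_cast h
  have e : (k : ℝ) + δ + 1 - i = (k + δ + 1 - (i + 1 : ℕ)) + 1 := by push_cast; ring
  rw [gammaRatio, gammaRatio, e, Real.Gamma_add_one (by push_cast; linarith)]
  push_cast
  ring

lemma gammaRatio_succ {δ : ℝ} (hδ : 0 < δ) {i k : ℕ} (h : i ≤ k) :
    (k + 1) * gammaRatio δ i (k + 1) = (k + 1 + δ - i) * gammaRatio δ i k := by
  have hik : (i : ℝ) ≤ k := by exact_mod_cast h
  have e : ((k + 1 : ℕ) : ℝ) + δ + 1 - i = (k + δ + 1 - i) + 1 := by push_cast; ring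
  have hG : Real.Gamma (k + 1) ≠ 0 := (Real.Gamma_pos_of_pos (by positivity)).ne'
  have hk : (k : ℝ) + 1 ≠ 0 := by positivity
  rw [gammaRatio, gammaRatio, e, Real.Gamma_add_one (by linarith)]
  push_cast
  rw [Real.Gamma_add_one hk]
  field_simp
  ring

lemma cesaroDiff_eq {δ : ℝ} (hδ : 0 < δ) {i k : ℕ} (h : i ≤ k) :
    cesaroDiff δ i k = (∏ l ∈ Finset.range i, (δ - l)) / Real.Gamma (δ + 1) * gammaRatio δ i k := by
  induction i generalizing k with
  | zero =>
    have hk : ¬ ((k : ℤ) < 0) := by omega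
    simp [cesaroDiff, cesaroAZ, cesaroA, gammaRatio, hk]
    ring
  | succ i ih =>
    obtain ⟨k, rfl⟩ : ∃ r, k = r + 1 := ⟨k - 1, by omega⟩
    have hik : (i : ℝ) ≤ k := by exact_mod_cast (show i ≤ k by omega)
    have e : ((k + 1 : ℕ) : ℤ) - 1 = (k : ℕ) := by push_cast; ring
    change cesaroDiff δ i _ - cesaroDiff δ i _ = _
    rw [e, ih (by omega), ih (by omega), Finset.prod_range_succ]
    have h1 := gammaRatio_succ hδ (show i ≤ k by omega)
    have h2 := gammaRatio_eq_mul hδ (show i ≤ k + 1 by omega)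
    have hne : (k : ℝ) + 1 + δ - i ≠ 0 := by linarith
    have h3 : gammaRatio δ i k = (k + 1) * gammaRatio δ (i + 1) (k + 1) := by
      apply mul_left_cancel₀ hne
      rw [← h1, h2]
      push_cast
      ring
    rw [h2, h3]
    push_cast
    ring

lemma gammaRatio_mem_cesaroSpan {δ : ℝ} (hδ : 0 < δ) {i : ℕ} (hi : i ≤ ⌈δ⌉₊ + 1)
    (hne : ∏ l ∈ Finset.range i, (δ - l) ≠ 0) : gammaRatio δ i ∈ cesaroSpan δ := by
  have hG : Real.Gamma (δ + 1) ≠ 0 := (Real.Gamma_pos_of_pos (by positivity)).ne'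
  have h := Submodule.smul_mem _ ((∏ l ∈ Finset.range i, (δ - l)) / Real.Gamma (δ + 1))⁻¹
    (cesaroDiff_mem_cesaroSpan δ i 0 (by omega))
  refine cesaroSpan_of_eventuallyEq h ?_
  filter_upwards [eventually_ge_atTop i] with k hk
  simp only [Pi.smul_apply, Nat.cast_zero, sub_zero, smul_eq_mul, cesaroDiff_eq hδ hk]
  field_simp

lemma gammaRatio_zero_eq_prod_mul {δ : ℝ} (hδ : 0 < δ) {i k : ℕ} (h : i ≤ k) :
    gammaRatio δ 0 k = (∏ l ∈ Finset.range i, (k + δ - l)) * gammaRatio δ i k := by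
  induction i with
  | zero => simp
  | succ i ih =>
    rw [ih (by omega), gammaRatio_eq_mul hδ (show i ≤ k by omega), Finset.prod_range_succ]
    ring

lemma exists_sum_div_prod (δ : ℝ) {Q : ℝ → ℝ} (hQ : AnalyticAt ℝ Q 0) (n : ℕ) :
    ∃ (c : ℕ → ℝ) (g : ℝ → ℝ), AnalyticAt ℝ g 0 ∧ ∀ x, Q x =
      ∑ i ∈ Finset.range n, c i * (x ^ i / ∏ l ∈ Finset.range i, (1 + (δ - l) * x)) +
        x ^ n * g x := by
  induction n with
  | zero => exact ⟨0, Q, hQ, by simp⟩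
  | succ n ih =>
    obtain ⟨c, g, hg, hQg⟩ := ih
    obtain ⟨g1, hg1, -, hgg⟩ := hg.exists_eq_add_mul
    have hua : AnalyticAt ℝ (fun x : ℝ => (∏ l ∈ Finset.range n, (1 + (δ - l) * x))⁻¹) 0 :=
      AnalyticAt.inv (Finset.analyticAt_fun_prod _ fun l _ => by fun_prop) (by simp)
    obtain ⟨v, hv, -, huv⟩ := hua.exists_eq_add_mul
    refine ⟨fun i => if i = n then g 0 else c i, fun x => g1 x - g 0 * v x, by fun_prop,
      fun x => ?_⟩
    have e := huv x
    simp only [mul_zero, add_zero, Finset.prod_const_one, inv_one] at e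
    dsimp only
    rw [hQg x, hgg x, Finset.sum_range_succ, if_pos rfl, div_eq_mul_inv (x ^ n), e]
    have : ∑ i ∈ Finset.range n, (if i = n then g 0 else c i) *
        (x ^ i / ∏ l ∈ Finset.range i, (1 + (δ - l) * x)) =
        ∑ i ∈ Finset.range n, c i * (x ^ i / ∏ l ∈ Finset.range i, (1 + (δ - l) * x)) :=
      Finset.sum_congr rfl fun i hi => by rw [if_neg (Finset.mem_range.1 hi).ne]
    rw [this]
    ring

lemma gammaRatio_zero_pos {δ : ℝ} (hδ : 0 < δ) (k : ℕ) : 0 < gammaRatio δ 0 k :=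
  div_pos (Real.Gamma_pos_of_pos (by simp; positivity)) (Real.Gamma_pos_of_pos (by positivity))

lemma log_gammaRatio_asymptotic {δ : ℝ} (hδ : 0 < δ) (n : ℕ) :
    ∃ P : Polynomial ℝ,
      (fun k : ℕ => δ * Real.log k - Real.log (gammaRatio δ 0 k) - P.eval ((k : ℝ)⁻¹)) =O[atTop]
        fun k : ℕ => ((k : ℝ)⁻¹) ^ n := by
  refine exists_polynomial_isBigO_of_sub_eventuallyEq
    (l := fun x => (δ + 1) * Real.log (1 + x) - Real.log (1 + (δ + 1) * x)) ?_ (by simp) ?_ ?_ n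
  · exact (analyticAt_const.mul (AnalyticAt.log (by fun_prop) (by simp))).sub
      (AnalyticAt.log (by fun_prop) (by simp))
  · have h1 := ((((hasDerivAt_id' (0 : ℝ)).const_add 1).log (by simp)).const_mul (δ + 1)).sub
      ((((hasDerivAt_id' (0 : ℝ)).const_mul (δ + 1)).const_add 1).log (by simp))
    exact (h1.congr_deriv (by simp)).deriv
  · filter_upwards [eventually_gt_atTop 0] with k hk
    have hk0 : (0 : ℝ) < k := by exact_mod_cast hk
    have hB := gammaRatio_zero_pos hδ
    have h := gammaRatio_succ hδ (Nat.zero_le k)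
    have h2 := congrArg Real.log h
    rw [Real.log_mul (by positivity) (hB _).ne', Nat.cast_zero, sub_zero,
      Real.log_mul (by positivity) (hB _).ne'] at h2
    have e1 : 1 + (k : ℝ)⁻¹ = (k + 1) / k := by field_simp
    have e2 : 1 + (δ + 1) * (k : ℝ)⁻¹ = (k + 1 + δ) / k := by field_simp; ring
    rw [e1, e2, Real.log_div (by positivity) (by positivity),
      Real.log_div (by positivity) (by positivity)]
    push_cast
    linarith

lemma rpow_eq_gammaRatio_mul_exp {δ : ℝ} (hδ : 0 < δ) {k : ℕ} (hk : 0 < k) :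
    (k : ℝ) ^ δ =
      gammaRatio δ 0 k * Real.exp (δ * Real.log k - Real.log (gammaRatio δ 0 k)) := by
  have hB := gammaRatio_zero_pos hδ k
  rw [Real.exp_sub, Real.exp_log hB, Real.rpow_def_of_pos (by exact_mod_cast hk), mul_comm δ]
  field_simp

lemma gammaRatio_zero_isBigO {δ : ℝ} (hδ : 0 < δ) :
    gammaRatio δ 0 =O[atTop] fun k : ℕ => (k : ℝ) ^ δ := by
  obtain ⟨P, hP⟩ := log_gammaRatio_asymptotic hδ 0
  have hPb := AnalyticAt.isBigO_one_inv_nat (g := fun x => P.eval x)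
    (AnalyticOnNhd.eval_polynomial P 0 trivial)
  simp only [pow_zero] at hP
  have h := hP.add hPb
  simp only [sub_add_cancel] at h
  obtain ⟨C, hC⟩ := h.bound
  refine IsBigO.of_bound (Real.exp C) ?_
  filter_upwards [hC, eventually_gt_atTop 0] with k hk hk0
  have hB := gammaRatio_zero_pos hδ k
  rw [rpow_eq_gammaRatio_mul_exp hδ hk0, norm_mul, mul_left_comm, ← mul_one ‖gammaRatio δ 0 k‖,
    mul_assoc]
  gcongr
  rw [one_mul, Real.norm_of_nonneg (Real.exp_pos _).le, ← Real.exp_add, Real.one_le_exp_iff]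
  have := neg_abs_le (δ * Real.log k - Real.log (gammaRatio δ 0 k))
  simp only [Real.norm_eq_abs, abs_one, mul_one] at hk
  linarith

lemma rpow_mul_inv_pow_le {δ : ℝ} {k : ℕ} (hk : 0 < k) :
    (k : ℝ) ^ δ * ((k : ℝ)⁻¹) ^ (⌈δ⌉₊ + 2) ≤ ((k : ℝ)⁻¹) ^ 2 := by
  have hk1 : (1 : ℝ) ≤ k := by exact_mod_cast hk
  have h : (k : ℝ) ^ δ ≤ (k : ℝ) ^ ⌈δ⌉₊ := by
    rw [← Real.rpow_natCast]
    exact Real.rpow_le_rpow_of_exponent_le hk1 (Nat.le_ceil δ)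
  calc (k : ℝ) ^ δ * ((k : ℝ)⁻¹) ^ (⌈δ⌉₊ + 2)
      ≤ (k : ℝ) ^ ⌈δ⌉₊ * ((k : ℝ)⁻¹) ^ (⌈δ⌉₊ + 2) := by gcongr
    _ = ((k : ℝ)⁻¹) ^ 2 := by
      rw [pow_add, ← mul_assoc, ← mul_pow, mul_inv_cancel₀ (by positivity), one_pow, one_mul]

lemma gammaRatio_mul_isBigO {δ : ℝ} (hδ : 0 < δ) {g : ℕ → ℝ}
    (hg : g =O[atTop] fun k : ℕ => ((k : ℝ)⁻¹) ^ (⌈δ⌉₊ + 2)) :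
    (fun k => gammaRatio δ 0 k * g k) =O[atTop] fun k : ℕ => ((k : ℝ)⁻¹) ^ 2 := by
  refine ((gammaRatio_zero_isBigO hδ).mul hg).trans (IsBigO.of_bound 1 ?_)
  filter_upwards [eventually_gt_atTop 0] with k hk
  rw [one_mul, Real.norm_of_nonneg (by positivity), Real.norm_of_nonneg (by positivity)]
  exact rpow_mul_inv_pow_le hk

lemma gammaRatio_mul_analytic_mem_cesaroSpan {δ : ℝ} (hδ : 0 < δ) (hne : ∀ l : ℕ, δ ≠ l)
    {Q : ℝ → ℝ} (hQ : AnalyticAt ℝ Q 0) :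
    (fun k : ℕ => gammaRatio δ 0 k * Q ((k : ℝ)⁻¹)) ∈ cesaroSpan δ := by
  obtain ⟨c, g, hg, hQg⟩ := exists_sum_div_prod δ hQ (⌈δ⌉₊ + 2)
  have hsum : ∑ i ∈ Finset.range (⌈δ⌉₊ + 2), c i • gammaRatio δ i ∈ cesaroSpan δ :=
    Submodule.sum_mem _ fun i hi => Submodule.smul_mem _ _ <|
      gammaRatio_mem_cesaroSpan hδ (by have := Finset.mem_range.1 hi; omega)
        (Finset.prod_ne_zero_iff.2 fun l _ => sub_ne_zero.2 (hne l))
  refine cesaroSpan_of_isBigO_sub hsum ?_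
  have hO := (isBigO_refl (fun k : ℕ => ((k : ℝ)⁻¹) ^ (⌈δ⌉₊ + 2)) atTop).mul hg.isBigO_one_inv_nat
  simp only [mul_one] at hO
  refine (gammaRatio_mul_isBigO hδ hO).congr' ?_ EventuallyEq.rfl
  filter_upwards [eventually_ge_atTop (⌈δ⌉₊ + 2)] with k hk
  have hk0 : (0 : ℝ) < k := by exact_mod_cast (show 0 < k by omega)
  have hterm : ∀ i ∈ Finset.range (⌈δ⌉₊ + 2), gammaRatio δ 0 k *
      (c i * (((k : ℝ)⁻¹) ^ i / ∏ l ∈ Finset.range i, (1 + (δ - l) * (k : ℝ)⁻¹))) =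
      c i * gammaRatio δ i k := by
    intro i hi
    have hik : i ≤ k := by have := Finset.mem_range.1 hi; omega
    have hprod : ∏ l ∈ Finset.range i, (k + δ - l) =
        (k : ℝ) ^ i * ∏ l ∈ Finset.range i, (1 + (δ - l) * (k : ℝ)⁻¹) := by
      rw [← Finset.card_range i, ← Finset.prod_const, Finset.card_range, ← Finset.prod_mul_distrib]
      refine Finset.prod_congr rfl fun l _ => ?_
      field_simp
      ring
    have hpos : 0 < ∏ l ∈ Finset.range i, ((k : ℝ) + δ - l) := Finset.prod_pos fun l hl => by
      have : (l : ℝ) ≤ k := by exact_mod_cast (Finset.mem_range.1 hl).le.trans hik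
      linarith
    rw [hprod] at hpos
    have hpos' := (pos_iff_pos_of_mul_pos hpos).1 (by positivity)
    rw [gammaRatio_zero_eq_prod_mul hδ hik, hprod, inv_pow]
    have hki : (k : ℝ) ^ i ≠ 0 := by positivity
    generalize ∏ l ∈ Finset.range i, (1 + (δ - l) * (k : ℝ)⁻¹) = q at hpos'
    field_simp
  rw [hQg, mul_add, Finset.mul_sum, Finset.sum_congr rfl hterm]
  simp

lemma rpow_mul_inv_pow_mem_cesaroSpan {δ : ℝ} (hδ : 0 < δ) (hne : ∀ l : ℕ, δ ≠ l) (i : ℕ) :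
    (fun k : ℕ => (k : ℝ) ^ δ * ((k : ℝ)⁻¹) ^ i) ∈ cesaroSpan δ := by
  obtain ⟨P, hP⟩ := log_gammaRatio_asymptotic hδ (⌈δ⌉₊ + 2)
  set b := fun k : ℕ => δ * Real.log k - Real.log (gammaRatio δ 0 k) - P.eval ((k : ℝ)⁻¹) with hb
  have hPa : AnalyticAt ℝ (fun x => P.eval x) 0 := AnalyticOnNhd.eval_polynomial P 0 trivial
  have hQ : AnalyticAt ℝ (fun x => x ^ i * Real.exp (P.eval x)) 0 :=
    (analyticAt_id.pow i).mul hPa.rexp'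
  have hb0 : Tendsto b atTop (𝓝 0) := by
    refine hP.trans_tendsto ?_
    simpa using (tendsto_inv_atTop_nhds_zero_nat (𝕜 := ℝ)).pow (⌈δ⌉₊ + 2)
  have hexp : (fun k => Real.exp (b k) - 1) =O[atTop] b := by
    have := (Real.hasDerivAt_exp 0).differentiableAt.isBigO_sub.comp_tendsto hb0
    simpa [Function.comp_def] using this
  have hO := hQ.isBigO_one_inv_nat.mul (hexp.trans hP)
  simp only [one_mul] at hO
  refine cesaroSpan_of_isBigO_sub (gammaRatio_mul_analytic_mem_cesaroSpan hδ hne hQ)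
    ((gammaRatio_mul_isBigO hδ hO).congr' ?_ EventuallyEq.rfl)
  filter_upwards [eventually_gt_atTop 0] with k hk
  have e : δ * Real.log k - Real.log (gammaRatio δ 0 k) = b k + P.eval ((k : ℝ)⁻¹) := by
    simp [hb]
  rw [rpow_eq_gammaRatio_mul_exp hδ hk, e, Real.exp_add]
  ring

lemma pow_mul_gammaRatio_mem_cesaroSpan {n : ℕ} (hn : 0 < n) (d i : ℕ) (hd : d ≤ i) (hi : i ≤ n) :
    (fun k : ℕ => (k : ℝ) ^ d * gammaRatio n i k) ∈ cesaroSpan n := by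
  have hn' : (0 : ℝ) < n := by exact_mod_cast hn
  induction d generalizing i with
  | zero =>
    simp only [pow_zero, one_mul]
    refine gammaRatio_mem_cesaroSpan hn' (by simp; omega) (Finset.prod_ne_zero_iff.2 fun l hl => ?_)
    have : (l : ℝ) < n := by exact_mod_cast (Finset.mem_range.1 hl).trans_le hi
    exact (sub_pos.2 this).ne'
  | succ d ih =>
    obtain ⟨i, rfl⟩ : ∃ r, i = r + 1 := ⟨i - 1, by omega⟩
    refine cesaroSpan_of_eventuallyEq (sub_mem (ih i (by omega) (by omega))
      (Submodule.smul_mem _ ((n : ℝ) - i) (ih (i + 1) (by omega) hi))) ?_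
    filter_upwards [eventually_ge_atTop i] with k hk
    simp only [Pi.sub_apply, Pi.smul_apply, smul_eq_mul, gammaRatio_eq_mul hn' hk]
    ring

lemma natCast_pow_mem_cesaroSpan {n : ℕ} (hn : 0 < n) {d : ℕ} (hd : d ≤ n) :
    (fun k : ℕ => (k : ℝ) ^ d) ∈ cesaroSpan n := by
  convert pow_mul_gammaRatio_mem_cesaroSpan hn d n hd le_rfl using 2 with k
  have hG : Real.Gamma (k + 1) ≠ 0 := (Real.Gamma_pos_of_pos (by positivity)).ne'
  rw [gammaRatio, show (k : ℝ) + n + 1 - n = k + 1 by ring, div_self hG, mul_one]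

lemma AnalyticAt.exists_sum_pow_add {f : ℝ → ℝ} (hf : AnalyticAt ℝ f 0) (n : ℕ) :
    ∃ (c : ℕ → ℝ) (g : ℝ → ℝ), AnalyticAt ℝ g 0 ∧
      ∀ x, f x = ∑ i ∈ Finset.range n, c i * x ^ i + x ^ n * g x := by
  induction n generalizing f with
  | zero => exact ⟨0, f, hf, by simp⟩
  | succ n ih =>
    obtain ⟨f1, hf1, -, hff⟩ := hf.exists_eq_add_mul
    obtain ⟨c, g, hg, hfg⟩ := ih hf1
    refine ⟨fun i => Nat.casesOn i (f 0) c, g, hg, fun x => ?_⟩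
    rw [Finset.sum_range_succ', hff x, hfg x, mul_add, Finset.mul_sum]
    have : ∀ i, x * (c i * x ^ i) = c i * x ^ (i + 1) := fun i => by ring
    simp only [this, pow_zero, mul_one, pow_succ' x n]
    change _ = _ + f 0 + _
    ring

lemma exists_expansion {δ : ℝ} (hδ : 0 < δ) :
    ∃ (n : ℕ) (f : ℕ → ℕ → ℝ), (∀ i ∈ Finset.range n, f i ∈ cesaroSpan δ) ∧
      ∃ C : ℝ, ∀ᶠ k : ℕ in atTop, ∀ ε : ℝ, 0 < ε → ε ≤ 1 →
        |((k : ℝ) + ε) ^ δ - ∑ i ∈ Finset.range n, ε ^ i * f i k| ≤ C * ((k : ℝ)⁻¹) ^ 2 := by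
  by_cases hne : ∀ l : ℕ, δ ≠ l
  · have ha : AnalyticAt ℝ (fun y : ℝ => Real.exp (Real.log (1 + y) * δ)) 0 :=
      ((AnalyticAt.log (by fun_prop) (by simp)).mul analyticAt_const).rexp'
    obtain ⟨c, g, hg, hc⟩ := ha.exists_sum_pow_add (⌈δ⌉₊ + 2)
    refine ⟨⌈δ⌉₊ + 2, fun i => c i • fun k : ℕ => (k : ℝ) ^ δ * ((k : ℝ)⁻¹) ^ i,
      fun i _ => Submodule.smul_mem _ _ (rpow_mul_inv_pow_mem_cesaroSpan hδ hne i), |g 0| + 1, ?_⟩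
    have hgb : ∀ᶠ y in 𝓝 (0 : ℝ), |g y| < |g 0| + 1 :=
      hg.continuousAt.abs.eventually_lt_const (by simp)
    obtain ⟨r, hr, hgr⟩ := Metric.eventually_nhds_iff.1 hgb
    filter_upwards [eventually_gt_atTop 0,
      (tendsto_inv_atTop_nhds_zero_nat (𝕜 := ℝ)).eventually_lt_const hr] with k hk hkr ε hε hε1
    have hk0 : (0 : ℝ) < k := by exact_mod_cast hk
    have hx : ε * (k : ℝ)⁻¹ ≤ (k : ℝ)⁻¹ := mul_le_of_le_one_left (by positivity) hε1
    have hgx : |g (ε * (k : ℝ)⁻¹)| ≤ |g 0| + 1 := by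
      refine (hgr ?_).le
      rw [Real.dist_eq, sub_zero, abs_of_nonneg (by positivity)]
      exact hx.trans_lt hkr
    have e : ((k : ℝ) + ε) ^ δ = (k : ℝ) ^ δ * Real.exp (Real.log (1 + ε * (k : ℝ)⁻¹) * δ) := by
      rw [← Real.rpow_def_of_pos (by positivity), ← Real.mul_rpow (by positivity) (by positivity)]
      congr 1
      field_simp
    have e2 : ((k : ℝ) + ε) ^ δ - ∑ i ∈ Finset.range (⌈δ⌉₊ + 2),
        ε ^ i * (c i • fun k : ℕ => (k : ℝ) ^ δ * ((k : ℝ)⁻¹) ^ i) k =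
        (k : ℝ) ^ δ * (ε * (k : ℝ)⁻¹) ^ (⌈δ⌉₊ + 2) * g (ε * (k : ℝ)⁻¹) := by
      rw [e, hc, mul_add, Finset.mul_sum, add_sub_right_comm, ← Finset.sum_sub_distrib,
        Finset.sum_eq_zero, zero_add, mul_assoc]
      intro i _
      simp only [Pi.smul_apply, smul_eq_mul]
      ring
    rw [e2, abs_mul, abs_of_nonneg (by positivity), mul_comm]
    refine mul_le_mul hgx ?_ (by positivity) (by positivity)
    refine le_trans ?_ (rpow_mul_inv_pow_le (δ := δ) hk)
    gcongr
  · push Not at hne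
    obtain ⟨n, rfl⟩ := hne
    have hn : 0 < n := by exact_mod_cast hδ
    refine ⟨n + 1, fun i => (n.choose i : ℝ) • fun k : ℕ => (k : ℝ) ^ (n - i),
      fun i _ => Submodule.smul_mem _ _ (natCast_pow_mem_cesaroSpan hn (Nat.sub_le n i)), 0, ?_⟩
    refine Eventually.of_forall fun k ε _ _ => ?_
    rw [Real.rpow_natCast, add_comm, add_pow, ← Finset.sum_sub_distrib, Finset.sum_eq_zero]
    · simp
    · intro i _
      simp only [Pi.smul_apply, smul_eq_mul]
      ring

lemma exists_coeff_bound {δ : ℝ} (hδ : 0 < δ) :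
    ∃ (p : Fin (⌈δ⌉₊ + 2) → Polynomial ℝ) (C : ℝ), ∀ᶠ k : ℕ in atTop, ∀ ε : ℝ, 0 < ε → ε ≤ 1 →
      |((k : ℝ) + ε) ^ δ - ∑ j, (p j).eval ε * cesaroAZ δ ((k : ℤ) - (j : ℕ))| ≤
        C * ((k : ℝ)⁻¹) ^ 2 := by
  obtain ⟨n, f, hf, C, hC⟩ := exists_expansion hδ
  have hex : ∀ i : ℕ, ∃ (c : Fin (⌈δ⌉₊ + 2) → ℝ) (B : ℝ), i ∈ Finset.range n → ∀ᶠ k : ℕ in atTop,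
      |f i k - ∑ j, c j * cesaroAZ δ ((k : ℤ) - (j : ℕ))| ≤ B * ((k : ℝ)⁻¹) ^ 2 := by
    intro i
    by_cases hi : i ∈ Finset.range n
    · obtain ⟨c, hc⟩ := exists_of_mem_cesaroSpan (hf i hi)
      obtain ⟨B, hB⟩ := hc.bound
      refine ⟨c, B, fun _ => ?_⟩
      filter_upwards [hB] with k hk
      rwa [Real.norm_eq_abs, Real.norm_of_nonneg (by positivity)] at hk
    · exact ⟨0, 0, fun h => absurd h hi⟩
  choose c B hB using hex
  refine ⟨fun j => ∑ i ∈ Finset.range n, Polynomial.C (c i j) * Polynomial.X ^ i,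
    C + ∑ i ∈ Finset.range n, B i, ?_⟩
  filter_upwards [hC, (Finset.eventually_all (Finset.range n)).2 hB] with k hk hkB ε hε hε1
  have e : ((k : ℝ) + ε) ^ δ - ∑ j : Fin (⌈δ⌉₊ + 2),
      (∑ i ∈ Finset.range n, Polynomial.C (c i j) * Polynomial.X ^ i : Polynomial ℝ).eval ε *
        cesaroAZ δ ((k : ℤ) - (j : ℕ)) =
      (((k : ℝ) + ε) ^ δ - ∑ i ∈ Finset.range n, ε ^ i * f i k) +
        ∑ i ∈ Finset.range n, ε ^ i * (f i k - ∑ j, c i j * cesaroAZ δ ((k : ℤ) - (j : ℕ))) := by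
    simp only [Polynomial.eval_finsetSum, Polynomial.eval_mul, Polynomial.eval_C,
      Polynomial.eval_pow, Polynomial.eval_X, mul_sub, Finset.sum_sub_distrib, Finset.mul_sum,
      Finset.sum_mul]
    rw [Finset.sum_comm]
    have : ∀ i j, c i j * ε ^ i * cesaroAZ δ ((k : ℤ) - (j : ℕ)) =
      ε ^ i * (c i j * cesaroAZ δ ((k : ℤ) - (j : ℕ))) := fun i j => by ring
    simp only [this]
    ring
  rw [e, add_mul, Finset.sum_mul]
  refine (abs_add_le _ _).trans (add_le_add (hk ε hε hε1)
    ((Finset.abs_sum_le_sum_abs _ _).trans (Finset.sum_le_sum fun i hi => ?_)))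
  rw [abs_mul, abs_of_nonneg (by positivity)]
  exact (mul_le_of_le_one_left (abs_nonneg _) (pow_le_one₀ hε.le hε1)).trans (hkB i hi)

end CesaroExpansion

theorem stmt_12 (δ : ℝ) (hδ : 0 < δ) :
    ∃ p : Fin (⌈δ⌉₊ + 2) → Polynomial ℝ, ∃ C > (0 : ℝ),
      ∀ ε : ℝ, 0 < ε → ε ≤ 1 → ∀ k : ℕ,
        |((k : ℝ) + ε) ^ δ - ∑ j, (p j).eval ε * cesaroAZ δ ((k : ℤ) - (j : ℕ))| ≤
          C / ((k : ℝ) + 1) ^ 2 := by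
  obtain ⟨p, C, hC⟩ := exists_coeff_bound hδ
  obtain ⟨K, hK⟩ := Filter.eventually_atTop.1 hC
  have hD : ∀ k : ℕ, ∃ D : ℝ, ∀ ε ∈ Set.Icc (0 : ℝ) 1,
      ‖((k : ℝ) + ε) ^ δ - ∑ j, (p j).eval ε * cesaroAZ δ ((k : ℤ) - (j : ℕ))‖ ≤ D := by
    intro k
    refine isCompact_Icc.exists_bound_of_continuousOn (Continuous.continuousOn ?_)
    refine ((continuous_const.add continuous_id).rpow_const fun _ => Or.inr hδ.le).sub
      (continuous_finsetSum _ fun j _ => (p j).continuous.mul continuous_const)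
  choose D hD using hD
  have hsum : 0 ≤ ∑ k ∈ Finset.range (K + 1), |D k| * ((k : ℝ) + 1) ^ 2 :=
    Finset.sum_nonneg fun _ _ => by positivity
  refine ⟨p, 4 * |C| + ∑ k ∈ Finset.range (K + 1), |D k| * ((k : ℝ) + 1) ^ 2 + 1, by positivity,
    fun ε hε hε1 k => ?_⟩
  rw [le_div_iff₀ (by positivity)]
  by_cases hk : k ∈ Finset.range (K + 1)
  · have h1 := Finset.single_le_sum (f := fun k : ℕ => |D k| * ((k : ℝ) + 1) ^ 2)
      (fun _ _ => by positivity) hk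
    have h2 : |((k : ℝ) + ε) ^ δ - ∑ j, (p j).eval ε * cesaroAZ δ ((k : ℤ) - (j : ℕ))| *
        ((k : ℝ) + 1) ^ 2 ≤ |D k| * ((k : ℝ) + 1) ^ 2 := by
      exact mul_le_mul_of_nonneg_right ((hD k ε ⟨hε.le, hε1⟩).trans (le_abs_self _))
        (by positivity)
    have := abs_nonneg C
    linarith
  · have hkK : K + 1 ≤ k := by simpa using hk
    have hk1 : (1 : ℝ) ≤ k := by exact_mod_cast (show 1 ≤ k by omega)
    have h1 : |((k : ℝ) + ε) ^ δ - ∑ j, (p j).eval ε * cesaroAZ δ ((k : ℤ) - (j : ℕ))| *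
        ((k : ℝ) + 1) ^ 2 ≤ |C| * ((k : ℝ)⁻¹) ^ 2 * (2 * k) ^ 2 := by
      refine mul_le_mul ((hK k (by omega) ε hε hε1).trans ?_) ?_ (by positivity) (by positivity)
      · gcongr
        exact le_abs_self C
      · gcongr
        linarith
    have h2 : |C| * ((k : ℝ)⁻¹) ^ 2 * (2 * k) ^ 2 = 4 * |C| := by
      field_simp
      ring
    linarith
end
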